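/- For every Turing machine T there exist a real number λ ≠ 0, a real-analytic vector field u : ℝ³ → ℝ³ with curl u = λ·u on all of ℝ³ (a Beltrami field, hence a stationary solution of the Euler equations in Euclidean ℝ³), and ε₀ > 0, such that u₃(x, y, 0) = 0 for all (x, y) and for every i ∈ ℕ there is an integral curve γ : [0, ∞) → ℝ³ of u with γ(0) = (p_{cᵢ}, 0) which remains in the plane {z = 0} and satisfies: for every configuration (q, τ), there exists t ≥ 0 with (γ(t)₁, γ(t)₂) ∈ U_{(q,τ)} if and only if Δᵏ(cᵢ) = (q, τ) for some k ≥ 0. In particular, T halts on cᵢ if and only if γ intersects ⋃_{τ ∈ 𝒜} U_{(q_halt, τ)} × {0}: there exists a Turing complete Beltrami field in Euclidean 3-space. -/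

import Mathlib

/-- A tape: finitely supported function `ℤ → Fin 2` (blank symbol `0`). -/
abbrev Tape := ℤ →₀ Fin 2

/-- A configuration of a Turing machine with state set `Fin m`. -/
abbrev Config (m : ℕ) := Fin m × Tape

/-- A Turing machine `T = (Q, q₀, q_halt, δ)` with `Q = Fin m`, tape alphabet `Fin 2`,
and transition function `δ : Q × Σ → Q × Σ × {-1,0,1}`. -/
structure TuringMachine (m : ℕ) where
  q0 : Fin m
  qhalt : Fin m
  hq : q0 ≠ qhalt
  δ : Fin m × Fin 2 → Fin m × Fin 2 × ℤ
  hδ : ∀ x, (δ x).2.2 = -1 ∨ (δ x).2.2 = 0 ∨ (δ x).2.2 = 1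

/-- The global transition function `Δ`: the identity on halted configurations; otherwise
write `δ(q, t 0) = (q', s, ε)`, replace the symbol at position `0` by `s` and
shift the tape by `ε` (the new tape is `n ↦ t̃ (n + ε)`). -/
noncomputable def TuringMachine.step {m : ℕ} (T : TuringMachine m) (c : Config m) :
    Config m :=
  if c.1 = T.qhalt then c
  else
    let d := T.δ (c.1, c.2 0)
    (d.1, Finsupp.equivMapDomain (Equiv.subRight d.2.2) (c.2.update 0 d.2.1))

/-- `r(t) = Σ_{i ≥ 0} t(i) 2^i`. -/
noncomputable def rEnc (t : Tape) : ℕ :=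
  ∑ i ∈ t.support.filter (fun i => 0 ≤ i), ((t i : ℕ) * 2 ^ i.toNat)

/-- `s(t) = Σ_{i ≥ 1} t(−i) 2^{i−1}`. -/
noncomputable def sEnc (t : Tape) : ℕ :=
  ∑ i ∈ t.support.filter (fun i => i < 0), ((t i : ℕ) * 2 ^ (-i - 1).toNat)

/-- The encoding `φ_enc(q, t) = 1/(2^{q+1} 3^{r(t)} 5^{s(t)}) ∈ (0,1)`. -/
noncomputable def phiEnc {m : ℕ} (c : Config m) : ℝ :=
  1 / (2 ^ ((c.1 : ℕ) + 1) * 3 ^ rEnc c.2 * 5 ^ sEnc c.2)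

/-- The open set `U_{(q,t)} = ⋃_{j,k ∈ ℕ} (2j + I_{(q,t)}) × (k − ε₀, k + ε₀) ⊂ ℝ²`. -/
def Uset {m : ℕ} (ε₀ : ℝ) (c : Config m) : Set (ℝ × ℝ) :=
  ⋃ (j : ℕ) (k : ℕ),
    (Set.Ioo (2 * (j : ℝ) + phiEnc c - phiEnc c ^ 2 / 8)
        (2 * (j : ℝ) + phiEnc c + phiEnc c ^ 2 / 8)) ×ˢ
      Set.Ioo ((k : ℝ) - ε₀) ((k : ℝ) + ε₀)

/-- Partial derivative `∂₁` of a function on `ℝ³`. -/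
noncomputable def pdx (g : ℝ × ℝ × ℝ → ℝ) (x : ℝ × ℝ × ℝ) : ℝ := fderiv ℝ g x (1, 0, 0)

/-- Partial derivative `∂₂` of a function on `ℝ³`. -/
noncomputable def pdy (g : ℝ × ℝ × ℝ → ℝ) (x : ℝ × ℝ × ℝ) : ℝ := fderiv ℝ g x (0, 1, 0)

/-- Partial derivative `∂₃` of a function on `ℝ³`. -/
noncomputable def pdz (g : ℝ × ℝ × ℝ → ℝ) (x : ℝ × ℝ × ℝ) : ℝ := fderiv ℝ g x (0, 0, 1)

/-- `curl u = (∂₂u₃ − ∂₃u₂, ∂₃u₁ − ∂₁u₃, ∂₁u₂ − ∂₂u₁)`. -/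
noncomputable def curl3 (u : ℝ × ℝ × ℝ → ℝ × ℝ × ℝ) (x : ℝ × ℝ × ℝ) : ℝ × ℝ × ℝ :=
  (pdy (fun y => (u y).2.2) x - pdz (fun y => (u y).2.1) x,
   pdz (fun y => (u y).1) x - pdx (fun y => (u y).2.2) x,
   pdx (fun y => (u y).2.1) x - pdy (fun y => (u y).1) x)

section BeltramiConstruction

open Set Filter Topology MeasureTheory

/-- Coefficient arrays of entire functions of three variables. -/
def EntireCoeff (d : ℕ × ℕ × ℕ → ℝ) : Prop :=
  ∀ R : ℝ, 0 ≤ R → ∃ C : ℝ, ∀ q : ℕ × ℕ × ℕ, |d q| * R ^ (q.1 + q.2.1 + q.2.2) ≤ C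

/-- The function with coefficient array `d`. -/
noncomputable def evalSeries (d : ℕ × ℕ × ℕ → ℝ) (x y z : ℝ) : ℝ :=
  ∑' q : ℕ × ℕ × ℕ, d q * (x ^ q.1 * y ^ q.2.1 * z ^ q.2.2)

lemma summable_half_pow₃ :
    Summable fun q : ℕ × ℕ × ℕ => (1 / 2 : ℝ) ^ (q.1 + q.2.1 + q.2.2) := by
  have h := summable_geometric_two
  have h2 : Summable fun q : ℕ × ℕ => (1 / 2 : ℝ) ^ q.1 * (1 / 2 : ℝ) ^ q.2 :=
    h.mul_of_nonneg h (fun _ => by positivity) (fun _ => by positivity)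
  refine (h.mul_of_nonneg h2 (fun _ => by positivity) (fun _ => by positivity)).congr fun q => ?_
  rw [pow_add, pow_add, mul_assoc]

lemma EntireCoeff.summable_abs {d : ℕ × ℕ × ℕ → ℝ} (hd : EntireCoeff d) {R : ℝ} (hR : 0 ≤ R) :
    Summable fun q : ℕ × ℕ × ℕ => |d q| * R ^ (q.1 + q.2.1 + q.2.2) := by
  obtain ⟨C, hC⟩ := hd (2 * R) (by positivity)
  refine Summable.of_nonneg_of_le (fun q => by positivity) (fun q => ?_)
    (summable_half_pow₃.mul_left C)
  have := hC q
  rw [mul_pow] at this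
  have h2 : (1 / 2 : ℝ) ^ (q.1 + q.2.1 + q.2.2) * 2 ^ (q.1 + q.2.1 + q.2.2) = 1 := by
    rw [← mul_pow]; norm_num
  calc |d q| * R ^ (q.1 + q.2.1 + q.2.2)
      = |d q| * (2 ^ (q.1 + q.2.1 + q.2.2) * R ^ (q.1 + q.2.1 + q.2.2)) *
        (1 / 2 : ℝ) ^ (q.1 + q.2.1 + q.2.2) := by
        linear_combination (-(|d q| * R ^ (q.1 + q.2.1 + q.2.2))) * h2
    _ ≤ _ := by gcongr

lemma norm_monomial_le {R x y z : ℝ} (hx : |x| ≤ R) (hy : |y| ≤ R) (hz : |z| ≤ R)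
    (q : ℕ × ℕ × ℕ) :
    |x ^ q.1 * y ^ q.2.1 * z ^ q.2.2| ≤ R ^ (q.1 + q.2.1 + q.2.2) := by
  rw [abs_mul, abs_mul, abs_pow, abs_pow, abs_pow, pow_add, pow_add]
  have : 0 ≤ R := (abs_nonneg x).trans hx
  gcongr

lemma EntireCoeff.summable {d : ℕ × ℕ × ℕ → ℝ} (hd : EntireCoeff d) (x y z : ℝ) :
    Summable fun q : ℕ × ℕ × ℕ => d q * (x ^ q.1 * y ^ q.2.1 * z ^ q.2.2) := by
  have hR : 0 ≤ |x| + |y| + |z| := by positivity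
  refine Summable.of_norm_bounded (hd.summable_abs hR) fun q => ?_
  rw [Real.norm_eq_abs, abs_mul]
  gcongr
  apply norm_monomial_le <;> linarith [abs_nonneg x, abs_nonneg y, abs_nonneg z]

/-- The coordinate selecting the `s`-th factor of the monomial with exponents `q`. -/
noncomputable def monomialCoord (q : ℕ × ℕ × ℕ) (s : ℕ) : ℝ × ℝ × ℝ →L[ℝ] ℝ :=
  if s < q.1 then ContinuousLinearMap.fst ℝ ℝ (ℝ × ℝ)
  else if s < q.1 + q.2.1 then
    (ContinuousLinearMap.fst ℝ ℝ ℝ).comp (ContinuousLinearMap.snd ℝ ℝ (ℝ × ℝ))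
  else (ContinuousLinearMap.snd ℝ ℝ ℝ).comp (ContinuousLinearMap.snd ℝ ℝ (ℝ × ℝ))

lemma norm_monomialCoord_le (q : ℕ × ℕ × ℕ) (s : ℕ) : ‖monomialCoord q s‖ ≤ 1 := by
  refine ContinuousLinearMap.opNorm_le_bound _ zero_le_one fun v => ?_
  unfold monomialCoord
  have h1 := norm_fst_le v
  have h2 := (norm_fst_le v.2).trans (norm_snd_le v)
  have h3 := (norm_snd_le v.2).trans (norm_snd_le v)
  split_ifs <;> simpa using by assumption

lemma prod_monomialCoord (q : ℕ × ℕ × ℕ) (v : ℝ × ℝ × ℝ) :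
    ∏ s : Fin (q.1 + q.2.1 + q.2.2), monomialCoord q s v =
      v.1 ^ q.1 * v.2.1 ^ q.2.1 * v.2.2 ^ q.2.2 := by
  rw [Fin.prod_univ_eq_prod_range (fun s => monomialCoord q s v), Finset.prod_range_add,
    Finset.prod_range_add]
  congr 1
  · congr 1
    · rw [Finset.prod_congr rfl (g := fun _ => v.1), Finset.prod_const, Finset.card_range]
      intro s hs
      simp [monomialCoord, Finset.mem_range.1 hs]
    · rw [Finset.prod_congr rfl (g := fun _ => v.2.1), Finset.prod_const, Finset.card_range]
      intro s hs
      simp [monomialCoord, Finset.mem_range.1 hs]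
  · rw [Finset.prod_congr rfl (g := fun _ => v.2.2), Finset.prod_const, Finset.card_range]
    intro s hs
    have h1 : ¬ (q.1 + q.2.1 + s < q.1) := by omega
    simp [monomialCoord, h1]

/-- The triples of exponents of total degree `N`. -/
def degreeFinset (N : ℕ) : Finset (ℕ × ℕ × ℕ) :=
  (Finset.range (N + 1) ×ˢ Finset.range (N + 1) ×ˢ Finset.range (N + 1)).filter
    fun q => q.1 + q.2.1 + q.2.2 = N

lemma mem_degreeFinset {N : ℕ} {q : ℕ × ℕ × ℕ} :
    q ∈ degreeFinset N ↔ q.1 + q.2.1 + q.2.2 = N := by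
  simp only [degreeFinset, Finset.mem_filter, Finset.mem_product, Finset.mem_range]
  omega

/-- The formal multilinear series with coefficient array `d`. -/
noncomputable def seriesOf (d : ℕ × ℕ × ℕ → ℝ) : FormalMultilinearSeries ℝ (ℝ × ℝ × ℝ) ℝ :=
  fun N => ∑ q ∈ degreeFinset N,
    d q • (ContinuousMultilinearMap.mkPiAlgebraFin ℝ N ℝ).compContinuousLinearMap
      fun s : Fin N => monomialCoord q s

lemma seriesOf_apply (d : ℕ × ℕ × ℕ → ℝ) (N : ℕ) (v : ℝ × ℝ × ℝ) :
    seriesOf d N (fun _ => v) =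
      ∑ q ∈ degreeFinset N, d q * (v.1 ^ q.1 * v.2.1 ^ q.2.1 * v.2.2 ^ q.2.2) := by
  simp only [seriesOf, _root_.sum_apply]
  refine Finset.sum_congr rfl fun q hq => ?_
  obtain rfl := mem_degreeFinset.1 hq
  rw [← prod_monomialCoord q v]
  simp [List.prod_ofFn]

lemma norm_seriesOf_le (d : ℕ × ℕ × ℕ → ℝ) (N : ℕ) :
    ‖seriesOf d N‖ ≤ ∑ q ∈ degreeFinset N, |d q| := by
  refine (norm_sum_le _ _).trans (Finset.sum_le_sum fun q _ => ?_)
  rw [norm_smul, Real.norm_eq_abs]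
  refine mul_le_of_le_one_right (abs_nonneg _) ?_
  refine (ContinuousMultilinearMap.norm_compContinuousLinearMap_le _ _).trans ?_
  rw [ContinuousMultilinearMap.norm_mkPiAlgebraFin, one_mul]
  exact Finset.prod_le_one (fun _ _ => norm_nonneg _) fun s _ => norm_monomialCoord_le q s

lemma EntireCoeff.radius_seriesOf {d : ℕ × ℕ × ℕ → ℝ} (hd : EntireCoeff d) :
    (seriesOf d).radius = ⊤ := by
  refine ENNReal.eq_top_of_forall_nnreal_le fun r => ?_
  have hs := hd.summable_abs r.coe_nonneg
  refine (seriesOf d).le_radius_of_bound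
    (∑' q : ℕ × ℕ × ℕ, |d q| * (r : ℝ) ^ (q.1 + q.2.1 + q.2.2)) fun N => ?_
  calc ‖seriesOf d N‖ * (r : ℝ) ^ N ≤ (∑ q ∈ degreeFinset N, |d q|) * (r : ℝ) ^ N := by
        gcongr; exact norm_seriesOf_le d N
    _ = ∑ q ∈ degreeFinset N, |d q| * (r : ℝ) ^ (q.1 + q.2.1 + q.2.2) := by
        rw [Finset.sum_mul]
        exact Finset.sum_congr rfl fun q hq => by rw [mem_degreeFinset.1 hq]
    _ ≤ _ := hs.sum_le_tsum _ fun q _ => by positivity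

lemma EntireCoeff.analyticAt {d : ℕ × ℕ × ℕ → ℝ} (hd : EntireCoeff d) (v : ℝ × ℝ × ℝ) :
    AnalyticAt ℝ (fun p : ℝ × ℝ × ℝ => evalSeries d p.1 p.2.1 p.2.2) v := by
  have h := (seriesOf d).hasFPowerSeriesOnBall (by rw [hd.radius_seriesOf]; simp)
  rw [hd.radius_seriesOf] at h
  have heq : (fun p : ℝ × ℝ × ℝ => evalSeries d p.1 p.2.1 p.2.2) = (seriesOf d).sum := by
    funext p
    have hs := hd.summable p.1 p.2.1 p.2.2
    have := hs.hasSum.tsum_fiberwise (fun q : ℕ × ℕ × ℕ => q.1 + q.2.1 + q.2.2)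
    rw [evalSeries, ← this.tsum_eq, FormalMultilinearSeries.sum]
    refine tsum_congr fun N => ?_
    rw [seriesOf_apply]
    have hset : ((fun q : ℕ × ℕ × ℕ => q.1 + q.2.1 + q.2.2) ⁻¹' {N}) = ↑(degreeFinset N) := by
      ext q; simp [mem_degreeFinset]
    rw [hset]
    exact Finset.tsum_subtype (degreeFinset N)
      (fun q => d q * (p.1 ^ q.1 * p.2.1 ^ q.2.1 * p.2.2 ^ q.2.2))
  rw [heq]
  exact h.analyticAt_of_mem (by simp)

lemma hasDerivAt_tsum_mul_pow {ι : Type*} (e : ι → ℕ) (w : ι → ℝ)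
    (hs : ∀ R : ℝ, 0 ≤ R → Summable fun q => |w q| * R ^ e q) (x : ℝ) :
    HasDerivAt (fun x => ∑' q, w q * x ^ e q) (∑' q, w q * (e q * x ^ (e q - 1))) x := by
  set R : ℝ := |x| + 1 with hR
  have hR1 : 1 ≤ R := by simp [hR]
  have hs2 := hs (2 * R) (by positivity)
  refine hasDerivAt_tsum_of_isPreconnected (g := fun q x => w q * x ^ e q)
    (g' := fun q x => w q * (e q * x ^ (e q - 1))) (t := Metric.ball (0 : ℝ) R) (y₀ := 0) hs2
    Metric.isOpen_ball (convex_ball _ _).isPreconnected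
    (fun q y _ => (hasDerivAt_pow (e q) y).const_mul (w q)) (fun q y hy => ?_)
    (by simpa using by positivity) ?_ (by simp [hR])
  · have hy' : |y| ≤ R := by simpa using (mem_ball_zero_iff.1 hy).le
    rw [Real.norm_eq_abs, abs_mul, abs_mul, abs_pow, Nat.abs_cast, mul_pow]
    have h1 : (e q : ℝ) ≤ 2 ^ e q := by exact_mod_cast Nat.lt_two_pow_self.le
    have h2 : |y| ^ (e q - 1) ≤ R ^ e q :=
      (pow_le_pow_left₀ (abs_nonneg _) hy' _).trans (pow_le_pow_right₀ hR1 (Nat.sub_le _ _))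
    gcongr
  · refine Summable.of_norm ((hs 0 le_rfl).congr fun q => ?_)
    by_cases h : e q = 0 <;> simp [h]

/-- Coefficient array of the first partial derivative. -/
def coeffX (d : ℕ × ℕ × ℕ → ℝ) (q : ℕ × ℕ × ℕ) : ℝ := (q.1 + 1) * d (q.1 + 1, q.2.1, q.2.2)

/-- Coefficient array of the second partial derivative. -/
def coeffY (d : ℕ × ℕ × ℕ → ℝ) (q : ℕ × ℕ × ℕ) : ℝ := (q.2.1 + 1) * d (q.1, q.2.1 + 1, q.2.2)

/-- Coefficient array of the third partial derivative. -/
def coeffZ (d : ℕ × ℕ × ℕ → ℝ) (q : ℕ × ℕ × ℕ) : ℝ := (q.2.2 + 1) * d (q.1, q.2.1, q.2.2 + 1)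

lemma EntireCoeff.add {d d' : ℕ × ℕ × ℕ → ℝ} (h : EntireCoeff d) (h' : EntireCoeff d') :
    EntireCoeff (d + d') := by
  intro R hR
  obtain ⟨C, hC⟩ := h R hR
  obtain ⟨C', hC'⟩ := h' R hR
  refine ⟨C + C', fun q => ?_⟩
  calc |d q + d' q| * R ^ (q.1 + q.2.1 + q.2.2)
      ≤ (|d q| + |d' q|) * R ^ (q.1 + q.2.1 + q.2.2) := by gcongr; exact abs_add_le _ _
    _ ≤ C + C' := by rw [add_mul]; exact add_le_add (hC q) (hC' q)

lemma EntireCoeff.neg {d : ℕ × ℕ × ℕ → ℝ} (h : EntireCoeff d) : EntireCoeff (-d) := by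
  intro R hR
  obtain ⟨C, hC⟩ := h R hR
  exact ⟨C, fun q => by simpa using hC q⟩

lemma EntireCoeff.of_shift {d d' : ℕ × ℕ × ℕ → ℝ} (h : EntireCoeff d)
    (hd' : ∀ q, ∃ q', q'.1 + q'.2.1 + q'.2.2 = q.1 + q.2.1 + q.2.2 + 1 ∧
      |d' q| ≤ (q.1 + q.2.1 + q.2.2 + 1 : ℕ) * |d q'|) : EntireCoeff d' := by
  intro R hR
  obtain ⟨C, hC⟩ := h (2 * R + 1) (by positivity)
  refine ⟨C, fun q => ?_⟩
  obtain ⟨q', h1, h2⟩ := hd' q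
  have h3 := hC q'
  rw [h1] at h3
  set n := q.1 + q.2.1 + q.2.2
  have h5 : ((n + 1 : ℕ) : ℝ) ≤ 2 ^ n := by exact_mod_cast Nat.lt_two_pow_self
  calc |d' q| * R ^ n ≤ ((n + 1 : ℕ) * |d q'|) * R ^ n := by gcongr
    _ ≤ (2 ^ n * |d q'|) * R ^ n := by gcongr
    _ = |d q'| * (2 * R) ^ n := by rw [mul_pow]; ring
    _ ≤ |d q'| * (2 * R + 1) ^ n := by gcongr; linarith
    _ ≤ |d q'| * (2 * R + 1) ^ (n + 1) := by
        gcongr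
        · linarith
        · omega
    _ ≤ C := h3

lemma EntireCoeff.coeffX {d : ℕ × ℕ × ℕ → ℝ} (h : EntireCoeff d) : EntireCoeff (coeffX d) :=
  h.of_shift fun q => ⟨(q.1 + 1, q.2.1, q.2.2), by simp only; ring, by
    have h0 : |(q.1 + 1 : ℝ)| = q.1 + 1 := abs_of_nonneg (by positivity)
    rw [_root_.coeffX, abs_mul, h0]
    gcongr
    push_cast
    linarith [(Nat.cast_nonneg q.2.1 : (0 : ℝ) ≤ _), (Nat.cast_nonneg q.2.2 : (0 : ℝ) ≤ _)]⟩

lemma EntireCoeff.coeffY {d : ℕ × ℕ × ℕ → ℝ} (h : EntireCoeff d) : EntireCoeff (coeffY d) :=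
  h.of_shift fun q => ⟨(q.1, q.2.1 + 1, q.2.2), by simp only; ring, by
    have h0 : |(q.2.1 + 1 : ℝ)| = q.2.1 + 1 := abs_of_nonneg (by positivity)
    rw [_root_.coeffY, abs_mul, h0]
    gcongr
    push_cast
    linarith [(Nat.cast_nonneg q.1 : (0 : ℝ) ≤ _), (Nat.cast_nonneg q.2.2 : (0 : ℝ) ≤ _)]⟩

lemma EntireCoeff.coeffZ {d : ℕ × ℕ × ℕ → ℝ} (h : EntireCoeff d) : EntireCoeff (coeffZ d) :=
  h.of_shift fun q => ⟨(q.1, q.2.1, q.2.2 + 1), by simp only; ring, by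
    have h0 : |(q.2.2 + 1 : ℝ)| = q.2.2 + 1 := abs_of_nonneg (by positivity)
    rw [_root_.coeffZ, abs_mul, h0]
    gcongr
    push_cast
    linarith [(Nat.cast_nonneg q.2.1 : (0 : ℝ) ≤ _), (Nat.cast_nonneg q.1 : (0 : ℝ) ≤ _)]⟩

lemma EntireCoeff.evalSeries_add {d d' : ℕ × ℕ × ℕ → ℝ} (h : EntireCoeff d)
    (h' : EntireCoeff d') (x y z : ℝ) :
    evalSeries (d + d') x y z = evalSeries d x y z + evalSeries d' x y z := by
  rw [evalSeries, evalSeries, evalSeries, ← (h.summable x y z).tsum_add (h'.summable x y z)]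
  exact tsum_congr fun q => by simp only [Pi.add_apply]; ring

lemma evalSeries_neg (d : ℕ × ℕ × ℕ → ℝ) (x y z : ℝ) :
    evalSeries (-d) x y z = -evalSeries d x y z := by
  rw [evalSeries, evalSeries, ← tsum_neg]
  exact tsum_congr fun q => by simp only [Pi.neg_apply]; ring

lemma EntireCoeff.hasDerivAt_x {d : ℕ × ℕ × ℕ → ℝ} (h : EntireCoeff d) (x y z : ℝ) :
    HasDerivAt (fun x => evalSeries d x y z) (evalSeries (_root_.coeffX d) x y z) x := by
  have := hasDerivAt_tsum_mul_pow (fun q : ℕ × ℕ × ℕ => q.1)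
    (fun q => d q * (y ^ q.2.1 * z ^ q.2.2)) (fun R hR => by
      refine (h.summable R |y| |z|).abs.congr fun q => ?_
      simp only [abs_mul, abs_pow, abs_abs, abs_of_nonneg hR]; ring) x
  convert this using 1
  · funext x
    exact tsum_congr fun q => by ring
  · have hi : Function.Injective fun q : ℕ × ℕ × ℕ => (q.1 + 1, q.2.1, q.2.2) := by
      rintro ⟨a, b, c⟩ ⟨a', b', c'⟩ hq
      simpa using hq
    rw [← hi.tsum_eq]
    · refine tsum_congr fun q => ?_
      simp only [_root_.coeffX, Nat.add_sub_cancel]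
      push_cast
      ring
    · rintro ⟨a, b, c⟩ hq
      rcases a with _ | a
      · simp at hq
      · exact ⟨(a, b, c), rfl⟩

lemma EntireCoeff.hasDerivAt_y {d : ℕ × ℕ × ℕ → ℝ} (h : EntireCoeff d) (x y z : ℝ) :
    HasDerivAt (fun y => evalSeries d x y z) (evalSeries (_root_.coeffY d) x y z) y := by
  have := hasDerivAt_tsum_mul_pow (fun q : ℕ × ℕ × ℕ => q.2.1)
    (fun q => d q * (x ^ q.1 * z ^ q.2.2)) (fun R hR => by
      refine (h.summable |x| R |z|).abs.congr fun q => ?_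
      simp only [abs_mul, abs_pow, abs_abs, abs_of_nonneg hR]; ring) y
  convert this using 1
  · funext y
    exact tsum_congr fun q => by ring
  · have hi : Function.Injective fun q : ℕ × ℕ × ℕ => (q.1, q.2.1 + 1, q.2.2) := by
      rintro ⟨a, b, c⟩ ⟨a', b', c'⟩ hq
      simpa using hq
    rw [← hi.tsum_eq]
    · refine tsum_congr fun q => ?_
      simp only [_root_.coeffY, Nat.add_sub_cancel]
      push_cast
      ring
    · rintro ⟨a, b, c⟩ hq
      rcases b with _ | b
      · simp at hq
      · exact ⟨(a, b, c), rfl⟩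

lemma EntireCoeff.hasDerivAt_z {d : ℕ × ℕ × ℕ → ℝ} (h : EntireCoeff d) (x y z : ℝ) :
    HasDerivAt (fun z => evalSeries d x y z) (evalSeries (_root_.coeffZ d) x y z) z := by
  have := hasDerivAt_tsum_mul_pow (fun q : ℕ × ℕ × ℕ => q.2.2)
    (fun q => d q * (x ^ q.1 * y ^ q.2.1)) (fun R hR => by
      refine (h.summable |x| |y| R).abs.congr fun q => ?_
      simp only [abs_mul, abs_pow, abs_abs, abs_of_nonneg hR]; ring) z
  convert this using 1
  · funext z
    exact tsum_congr fun q => by ring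
  · have hi : Function.Injective fun q : ℕ × ℕ × ℕ => (q.1, q.2.1, q.2.2 + 1) := by
      rintro ⟨a, b, c⟩ ⟨a', b', c'⟩ hq
      simpa using hq
    rw [← hi.tsum_eq]
    · refine tsum_congr fun q => ?_
      simp only [_root_.coeffZ, Nat.add_sub_cancel]
      push_cast
      ring
    · rintro ⟨a, b, c⟩ hq
      rcases c with _ | c
      · simp at hq
      · exact ⟨(a, b, c), rfl⟩

/-- Coefficient layers, in powers of `z`, of the odd solution of `Δw + w = 0` with
normal derivative `∑ c j k x ^ j y ^ k` on the plane `z = 0`. -/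
noncomputable def helmholtzLayer (c : ℕ → ℕ → ℝ) : ℕ → ℕ → ℕ → ℝ
  | 0 => c
  | m + 1 => fun j k =>
      -((j + 2) * (j + 1) * helmholtzLayer c m (j + 2) k +
        (k + 2) * (k + 1) * helmholtzLayer c m j (k + 2) + helmholtzLayer c m j k) /
        ((2 * m + 2) * (2 * m + 3))

/-- Coefficient array of the odd solution of `Δw + w = 0`. -/
noncomputable def helmholtzCoeff (c : ℕ → ℕ → ℝ) (q : ℕ × ℕ × ℕ) : ℝ :=
  if q.2.2 % 2 = 1 then helmholtzLayer c (q.2.2 / 2) q.1 q.2.1 else 0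

lemma abs_helmholtzLayer_le {c : ℕ → ℕ → ℝ} {C t : ℝ} (ht : 0 ≤ t)
    (hc : ∀ j k, |c j k| ≤ C * t ^ (j + k)) (m j k : ℕ) :
    |helmholtzLayer c m j k| * ((2 * m + 1).factorial * (j + k).factorial) ≤
      C * (j + k + 2 * m).factorial * t ^ (j + k) *
        ∏ i ∈ Finset.range m, (2 * t ^ 2 + 1 / ((i : ℝ) + 1) ^ 2) := by
  induction m generalizing j k with
  | zero =>
    have := hc j k
    simp only [helmholtzLayer, Finset.range_zero, Finset.prod_empty, mul_one, Nat.mul_zero,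
      Nat.zero_add, Nat.factorial_one, Nat.cast_one, one_mul, Nat.add_zero]
    calc |c j k| * ((j + k).factorial : ℝ) ≤ C * t ^ (j + k) * ((j + k).factorial : ℝ) := by
          gcongr
      _ = _ := by ring
  | succ m ih =>
    set P := ∏ i ∈ Finset.range m, (2 * t ^ 2 + 1 / ((i : ℝ) + 1) ^ 2) with hP
    have hP0 : 0 ≤ P := Finset.prod_nonneg fun i _ => by positivity
    have hC : 0 ≤ C := by simpa using (abs_nonneg _).trans (hc 0 0)
    have h1 := ih (j + 2) k
    have h2 := ih j (k + 2)
    have h3 := ih j k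
    rw [show j + 2 + k = j + k + 2 by ring] at h1
    rw [show j + (k + 2) = j + k + 2 by ring] at h2
    rw [Finset.prod_range_succ, ← hP]
    set J := j + k with hJ
    set a := |helmholtzLayer c m (j + 2) k|
    set b := |helmholtzLayer c m j (k + 2)|
    set e := |helmholtzLayer c m j k|
    have hjJ : (j : ℝ) ≤ J := by rw [hJ]; push_cast; linarith [(Nat.cast_nonneg k : (0:ℝ) ≤ k)]
    have hkJ : (k : ℝ) ≤ J := by rw [hJ]; push_cast; linarith [(Nat.cast_nonneg j : (0:ℝ) ≤ j)]
    have habs : |helmholtzLayer c (m + 1) j k| * ((2 * m + 2) * (2 * m + 3)) ≤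
        (J + 2) * (J + 1) * a + (J + 2) * (J + 1) * b + e := by
      have hpos : (0 : ℝ) < (2 * m + 2) * (2 * m + 3) := by positivity
      rw [helmholtzLayer, abs_div, abs_neg, abs_of_pos hpos, div_mul_cancel₀ _ hpos.ne']
      refine (abs_add_three _ _ _).trans ?_
      rw [abs_mul (((j : ℝ) + 2) * (j + 1)), abs_mul (((k : ℝ) + 2) * (k + 1)),
        abs_of_nonneg (by positivity : (0 : ℝ) ≤ (j + 2) * (j + 1)),
        abs_of_nonneg (by positivity : (0 : ℝ) ≤ (k + 2) * (k + 1))]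
      gcongr
    have f1 : ((2 * (m + 1) + 1).factorial : ℝ) =
        (2 * m + 2) * (2 * m + 3) * (2 * m + 1).factorial := by
      rw [show 2 * (m + 1) + 1 = 2 * m + 1 + 1 + 1 by ring, Nat.factorial_succ, Nat.factorial_succ]
      push_cast; ring
    have f2 : ((J + 2).factorial : ℝ) = (J + 2) * (J + 1) * J.factorial := by
      rw [Nat.factorial_succ, Nat.factorial_succ]; push_cast; ring
    have f3 : ((J + 2 * (m + 1)).factorial : ℝ) =
        (J + 2 * m + 1) * (J + 2 * m + 2) * (J + 2 * m).factorial := by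
      rw [show J + 2 * (m + 1) = J + 2 * m + 1 + 1 by ring, Nat.factorial_succ, Nat.factorial_succ]
      push_cast; ring
    rw [show J + 2 + 2 * m = J + 2 * (m + 1) by ring, f2] at h1 h2
    have key : (C * (J + 2 * m).factorial * t ^ J * P : ℝ) ≤
        C * (J + 2 * (m + 1)).factorial * t ^ J * P * (1 / ((m : ℝ) + 1) ^ 2) := by
      rw [f3]
      have h4 : (1 : ℝ) ≤ (J + 2 * m + 1) * (J + 2 * m + 2) * (1 / ((m : ℝ) + 1) ^ 2) := by
        rw [mul_one_div, one_le_div (by positivity)]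
        have := (Nat.cast_nonneg m : (0 : ℝ) ≤ m)
        have := (Nat.cast_nonneg J : (0 : ℝ) ≤ J)
        nlinarith [mul_nonneg (Nat.cast_nonneg m : (0 : ℝ) ≤ m) (Nat.cast_nonneg J : (0 : ℝ) ≤ J)]
      calc (C * (J + 2 * m).factorial * t ^ J * P : ℝ)
          = C * (J + 2 * m).factorial * t ^ J * P * 1 := by ring
        _ ≤ C * (J + 2 * m).factorial * t ^ J * P *
          ((J + 2 * m + 1) * (J + 2 * m + 2) * (1 / ((m : ℝ) + 1) ^ 2)) := by gcongr
        _ = _ := by ring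
    calc |helmholtzLayer c (m + 1) j k| * (((2 * (m + 1) + 1).factorial : ℝ) * J.factorial)
        = (|helmholtzLayer c (m + 1) j k| * ((2 * m + 2) * (2 * m + 3))) *
          ((2 * m + 1).factorial * J.factorial) := by rw [f1]; ring
      _ ≤ ((J + 2) * (J + 1) * a + (J + 2) * (J + 1) * b + e) *
          ((2 * m + 1).factorial * J.factorial) := by gcongr
      _ = a * ((2 * m + 1).factorial * ((J + 2) * (J + 1) * J.factorial)) +
          b * ((2 * m + 1).factorial * ((J + 2) * (J + 1) * J.factorial)) +
          e * ((2 * m + 1).factorial * J.factorial) := by ring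
      _ ≤ C * (J + 2 * (m + 1)).factorial * t ^ (J + 2) * P +
          C * (J + 2 * (m + 1)).factorial * t ^ (J + 2) * P +
          C * (J + 2 * m).factorial * t ^ J * P := add_le_add (add_le_add h1 h2) h3
      _ ≤ C * (J + 2 * (m + 1)).factorial * t ^ (J + 2) * P +
          C * (J + 2 * (m + 1)).factorial * t ^ (J + 2) * P +
          C * (J + 2 * (m + 1)).factorial * t ^ J * P * (1 / ((m : ℝ) + 1) ^ 2) := by gcongr
      _ = _ := by ring

lemma exists_prod_mul_pow_le {s A : ℝ} (hs : 0 ≤ s) (hA : 0 ≤ A) (hsA : s * A ≤ 1 / 2) :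
    ∃ D : ℝ, ∀ m : ℕ, (∏ i ∈ Finset.range m, (s + 1 / ((i : ℝ) + 1) ^ 2)) * A ^ m ≤ D := by
  set p : ℕ → ℝ := fun m => (∏ i ∈ Finset.range m, (s + 1 / ((i : ℝ) + 1) ^ 2)) * A ^ m with hp
  have hp0 : ∀ m, 0 ≤ p m := fun m =>
    mul_nonneg (Finset.prod_nonneg fun i _ => by positivity) (by positivity)
  obtain ⟨M, hM⟩ := exists_nat_gt (2 * A)
  have hstep : ∀ m, M ≤ m → p (m + 1) ≤ p m := by
    intro m hm
    have h1 : p (m + 1) = p m * (s * A + A / ((m : ℝ) + 1) ^ 2) := by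
      simp only [hp, Finset.prod_range_succ, pow_succ]; ring
    rw [h1]
    refine mul_le_of_le_one_right (hp0 m) ?_
    have h2 : A / ((m : ℝ) + 1) ^ 2 ≤ 1 / 2 := by
      have : (M : ℝ) ≤ m := by exact_mod_cast hm
      rw [div_le_iff₀ (by positivity)]
      nlinarith
    linarith
  refine ⟨∑ i ∈ Finset.range (M + 1), p i, fun m => ?_⟩
  rcases le_or_gt m M with h | h
  · exact Finset.single_le_sum (fun i _ => hp0 i) (Finset.mem_range.2 (by omega))
  · have h1 : p m ≤ p M := by
      induction m, h.le using Nat.le_induction with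
      | base => exact le_rfl
      | succ n hn ih =>
        rcases hn.eq_or_lt with rfl | hn'
        · exact hstep _ le_rfl
        · exact (hstep n hn).trans (ih hn')
    exact h1.trans (Finset.single_le_sum (fun i _ => hp0 i) (Finset.mem_range.2 (by omega)))

lemma entireCoeff_helmholtzCoeff {c : ℕ → ℕ → ℝ}
    (hc : ∀ R : ℝ, 0 ≤ R → ∃ C, ∀ j k, |c j k| * R ^ (j + k) ≤ C) :
    EntireCoeff (helmholtzCoeff c) := by
  intro R hR
  obtain ⟨C, hC⟩ := hc (4 * (R + 1)) (by positivity)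
  set t : ℝ := 1 / (4 * (R + 1)) with ht
  have ht0 : 0 ≤ t := by positivity
  have htR : t * (4 * (R + 1)) = 1 := by rw [ht]; field_simp
  have hC0 : 0 ≤ C := le_trans (by positivity) (hC 0 0)
  have hc' : ∀ j k, |c j k| ≤ C * t ^ (j + k) := fun j k => by
    calc |c j k| = |c j k| * (4 * (R + 1)) ^ (j + k) * t ^ (j + k) := by
          rw [mul_assoc, ← mul_pow, mul_comm (4 * (R + 1)), htR]; simp
      _ ≤ _ := by gcongr; exact hC j k
  have htR1 : 2 * t * R ≤ 1 / 2 := by nlinarith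
  obtain ⟨D, hD⟩ := exists_prod_mul_pow_le (s := 2 * t ^ 2) (A := 4 * R ^ 2) (by positivity)
    (by positivity) (by nlinarith [mul_nonneg ht0 hR])
  refine ⟨C * R * D, fun q => ?_⟩
  obtain ⟨j, k, n⟩ := q
  have hD0 : 0 ≤ D := le_trans zero_le_one (by simpa using hD 0)
  simp only [helmholtzCoeff]
  split_ifs with hn
  swap
  · simp; positivity
  obtain ⟨m, rfl⟩ : ∃ m, n = 2 * m + 1 := ⟨n / 2, by omega⟩
  rw [show (2 * m + 1) / 2 = m by omega]
  have h := abs_helmholtzLayer_le ht0 hc' m j k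
  have hDm := hD m
  set P := ∏ i ∈ Finset.range m, (2 * t ^ 2 + 1 / ((i : ℝ) + 1) ^ 2)
  have hP0 : 0 ≤ P := Finset.prod_nonneg fun i _ => by positivity
  rw [show j + k + (2 * m + 1) = (j + k) + 2 * m + 1 by ring]
  set J := j + k
  have hch : ((J + 2 * m).factorial : ℝ) ≤
      2 ^ (J + 2 * m) * ((2 * m + 1).factorial * J.factorial) := by
    have h1 : (J + 2 * m).factorial ≤ 2 ^ (J + 2 * m) * ((2 * m + 1).factorial * J.factorial) := by
      rw [← Nat.add_choose_mul_factorial_mul_factorial J (2 * m), mul_assoc]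
      refine Nat.mul_le_mul (Nat.choose_le_two_pow _ _) ?_
      rw [mul_comm]
      exact Nat.mul_le_mul (Nat.factorial_le (by omega)) le_rfl
    exact_mod_cast h1
  set F : ℝ := (2 * m + 1).factorial * J.factorial with hF
  have hF0 : 0 < F := by positivity
  have h2 : |helmholtzLayer c m j k| ≤ C * 2 ^ (J + 2 * m) * t ^ J * P := by
    refine le_of_mul_le_mul_right (h.trans ?_) hF0
    calc C * (J + 2 * m).factorial * t ^ J * P ≤ C * (2 ^ (J + 2 * m) * F) * t ^ J * P := by gcongr
      _ = _ := by ring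
  calc |helmholtzLayer c m j k| * R ^ (J + 2 * m + 1)
      ≤ C * 2 ^ (J + 2 * m) * t ^ J * P * R ^ (J + 2 * m + 1) := by gcongr
    _ = C * R * (2 * t * R) ^ J * (P * (4 * R ^ 2) ^ m) := by
        rw [mul_pow, mul_pow, mul_pow, show (4 : ℝ) = 2 ^ 2 by norm_num, ← pow_mul, ← pow_mul]
        ring
    _ ≤ C * R * 1 * D := by
        gcongr
        exact pow_le_one₀ (by positivity) (by linarith)
    _ = C * R * D := by ring

lemma helmholtzCoeff_eq (c : ℕ → ℕ → ℝ) :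
    coeffX (coeffX (helmholtzCoeff c)) + coeffY (coeffY (helmholtzCoeff c)) +
      coeffZ (coeffZ (helmholtzCoeff c)) + helmholtzCoeff c = 0 := by
  funext ⟨j, k, n⟩
  simp only [Pi.add_apply, Pi.zero_apply, coeffX, coeffY, coeffZ, helmholtzCoeff]
  rw [show (n + 1 + 1) % 2 = n % 2 by omega, show (n + 1 + 1) / 2 = n / 2 + 1 by omega]
  split_ifs with hn
  swap
  · simp
  obtain ⟨m, rfl⟩ : ∃ m, n = 2 * m + 1 := ⟨n / 2, by omega⟩
  rw [show (2 * m + 1) / 2 = m by omega, helmholtzLayer]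
  push_cast
  have : (2 * (m : ℝ) + 2) * (2 * m + 3) ≠ 0 := by positivity
  field_simp
  ring

lemma coeffX_coeffY (d) : coeffX (coeffY d) = coeffY (coeffX d) := by
  funext q; simp only [coeffX, coeffY]; ring

lemma coeffX_coeffZ (d) : coeffX (coeffZ d) = coeffZ (coeffX d) := by
  funext q; simp only [coeffX, coeffZ]; ring

lemma coeffY_coeffZ (d) : coeffY (coeffZ d) = coeffZ (coeffY d) := by
  funext q; simp only [coeffY, coeffZ]; ring

lemma coeffX_add (d d') : coeffX (d + d') = coeffX d + coeffX d' := by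
  funext q; simp only [coeffX, Pi.add_apply]; ring

lemma coeffY_add (d d') : coeffY (d + d') = coeffY d + coeffY d' := by
  funext q; simp only [coeffY, Pi.add_apply]; ring

lemma coeffZ_add (d d') : coeffZ (d + d') = coeffZ d + coeffZ d' := by
  funext q; simp only [coeffZ, Pi.add_apply]; ring

lemma coeffX_neg (d) : coeffX (-d) = -coeffX d := by
  funext q; simp only [coeffX, Pi.neg_apply]; ring

lemma coeffZ_neg (d) : coeffZ (-d) = -coeffZ d := by
  funext q; simp only [coeffZ, Pi.neg_apply]; ring

lemma evalSeries_eq_zero {d : ℕ × ℕ × ℕ → ℝ} (hd : ∀ j k, d (j, k, 0) = 0) (x y : ℝ) :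
    evalSeries d x y 0 = 0 := by
  rw [evalSeries, ← tsum_zero]
  refine tsum_congr fun q => ?_
  obtain ⟨j, k, n⟩ := q
  rcases n with _ | n
  · simp [hd]
  · simp

/-- The vector field on space with the given component coefficient arrays. -/
noncomputable def seriesField (d₁ d₂ d₃ : ℕ × ℕ × ℕ → ℝ) (p : ℝ × ℝ × ℝ) : ℝ × ℝ × ℝ :=
  (evalSeries d₁ p.1 p.2.1 p.2.2, evalSeries d₂ p.1 p.2.1 p.2.2, evalSeries d₃ p.1 p.2.1 p.2.2)

lemma EntireCoeff.fderiv_apply {d : ℕ × ℕ × ℕ → ℝ} (hd : EntireCoeff d) (p : ℝ × ℝ × ℝ) :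
    pdx (fun p => evalSeries d p.1 p.2.1 p.2.2) p = evalSeries (_root_.coeffX d) p.1 p.2.1 p.2.2 ∧
    pdy (fun p => evalSeries d p.1 p.2.1 p.2.2) p = evalSeries (_root_.coeffY d) p.1 p.2.1 p.2.2 ∧
    pdz (fun p => evalSeries d p.1 p.2.1 p.2.2) p =
      evalSeries (_root_.coeffZ d) p.1 p.2.1 p.2.2 := by
  obtain ⟨L, hD⟩ : ∃ L, HasFDerivAt (fun p : ℝ × ℝ × ℝ => evalSeries d p.1 p.2.1 p.2.2) L p :=
    ⟨_, (hd.analyticAt p).differentiableAt.hasFDerivAt⟩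
  simp only [pdx, pdy, pdz, hD.fderiv]
  refine ⟨?_, ?_, ?_⟩
  · have h1 : HasDerivAt (fun s : ℝ => (s, p.2.1, p.2.2)) ((1, 0, 0) : ℝ × ℝ × ℝ) p.1 :=
      (hasDerivAt_id _).prodMk ((hasDerivAt_const _ _).prodMk (hasDerivAt_const _ _))
    have h2 := HasFDerivAt.comp_hasDerivAt p.1 hD h1
    exact h2.unique (hd.hasDerivAt_x p.1 p.2.1 p.2.2)
  · have h1 : HasDerivAt (fun s : ℝ => (p.1, s, p.2.2)) ((0, 1, 0) : ℝ × ℝ × ℝ) p.2.1 :=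
      (hasDerivAt_const _ _).prodMk ((hasDerivAt_id _).prodMk (hasDerivAt_const _ _))
    have h2 := HasFDerivAt.comp_hasDerivAt p.2.1 hD h1
    exact h2.unique (hd.hasDerivAt_y p.1 p.2.1 p.2.2)
  · have h1 : HasDerivAt (fun s : ℝ => (p.1, p.2.1, s)) ((0, 0, 1) : ℝ × ℝ × ℝ) p.2.2 :=
      (hasDerivAt_const _ _).prodMk ((hasDerivAt_const _ _).prodMk (hasDerivAt_id _))
    have h2 := HasFDerivAt.comp_hasDerivAt p.2.2 hD h1
    exact h2.unique (hd.hasDerivAt_z p.1 p.2.1 p.2.2)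

lemma curl3_seriesField {d₁ d₂ d₃ : ℕ × ℕ × ℕ → ℝ} (h₁ : EntireCoeff d₁) (h₂ : EntireCoeff d₂)
    (h₃ : EntireCoeff d₃) :
    curl3 (seriesField d₁ d₂ d₃) = seriesField (coeffY d₃ + -coeffZ d₂) (coeffZ d₁ + -coeffX d₃)
      (coeffX d₂ + -coeffY d₁) := by
  funext p
  simp only [curl3, seriesField, h₁.fderiv_apply, h₂.fderiv_apply, h₃.fderiv_apply,
    h₃.coeffY.evalSeries_add h₂.coeffZ.neg,
    h₁.coeffZ.evalSeries_add h₃.coeffX.neg, h₂.coeffX.evalSeries_add h₁.coeffY.neg,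
    evalSeries_neg, sub_eq_add_neg]

/-- A potential on the plane with entire Taylor coefficients extends to a Beltrami field whose
restriction to the plane is the gradient of the potential. -/
theorem exists_beltrami_of_potential {c : ℕ → ℕ → ℝ}
    (hc : ∀ R : ℝ, 0 ≤ R → ∃ C, ∀ j k, |c j k| * R ^ (j + k) ≤ C) :
    ∃ u : ℝ × ℝ × ℝ → ℝ × ℝ × ℝ, (∀ p, AnalyticAt ℝ u p) ∧ (∀ p, curl3 u p = u p) ∧
      (∀ x y, (u (x, y, 0)).2.2 = 0) ∧
      (∀ x y, HasDerivAt (fun x => ∑' q : ℕ × ℕ, c q.1 q.2 * (x ^ q.1 * y ^ q.2))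
        (u (x, y, 0)).1 x) ∧
      (∀ x y, HasDerivAt (fun y => ∑' q : ℕ × ℕ, c q.1 q.2 * (x ^ q.1 * y ^ q.2))
        (u (x, y, 0)).2.1 y) := by
  set d := helmholtzCoeff c with hd
  have h : EntireCoeff d := entireCoeff_helmholtzCoeff hc
  have h₁ : EntireCoeff (coeffX (coeffZ d) + coeffY d) := h.coeffZ.coeffX.add h.coeffY
  have h₂ : EntireCoeff (coeffY (coeffZ d) + -coeffX d) := h.coeffZ.coeffY.add h.coeffX.neg
  have h₃ : EntireCoeff (coeffZ (coeffZ d) + d) := h.coeffZ.coeffZ.add h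
  have hPDE := helmholtzCoeff_eq c
  rw [← hd] at hPDE
  have hf : ∀ x y, ∑' q : ℕ × ℕ, c q.1 q.2 * (x ^ q.1 * y ^ q.2) =
      evalSeries (coeffZ d) x y 0 := by
    intro x y
    have hi : Function.Injective fun q : ℕ × ℕ => (q.1, q.2, 0) := by
      rintro ⟨a, b⟩ ⟨a', b'⟩ hq
      simpa using hq
    rw [evalSeries, ← hi.tsum_eq]
    · exact tsum_congr fun q => by simp [coeffZ, hd, helmholtzCoeff, helmholtzLayer]
    · rintro ⟨a, b, n⟩ hq
      rcases n with _ | n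
      · exact ⟨(a, b), rfl⟩
      · simp at hq
  have hX : ∀ x y, evalSeries (coeffX d) x y 0 = 0 :=
    evalSeries_eq_zero fun j k => by simp [coeffX, hd, helmholtzCoeff]
  have hY : ∀ x y, evalSeries (coeffY d) x y 0 = 0 :=
    evalSeries_eq_zero fun j k => by simp [coeffY, hd, helmholtzCoeff]
  refine ⟨seriesField (coeffX (coeffZ d) + coeffY d) (coeffY (coeffZ d) + -coeffX d)
    (coeffZ (coeffZ d) + d), fun p => (h₁.analyticAt p).prod
      ((h₂.analyticAt p).prod (h₃.analyticAt p)), fun p => ?_, ?_, ?_, ?_⟩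
  · rw [curl3_seriesField h₁ h₂ h₃]
    have e₁ : coeffY (coeffZ (coeffZ d) + d) + -coeffZ (coeffY (coeffZ d) + -coeffX d) =
        coeffX (coeffZ d) + coeffY d := by
      simp only [coeffX_coeffZ, coeffY_coeffZ, coeffY_add, coeffZ_add, coeffZ_neg]
      abel
    have e₂ : coeffZ (coeffX (coeffZ d) + coeffY d) + -coeffX (coeffZ (coeffZ d) + d) =
        coeffY (coeffZ d) + -coeffX d := by
      simp only [coeffX_coeffZ, coeffY_coeffZ, coeffX_add, coeffZ_add]
      abel
    have e₃ : coeffX (coeffY (coeffZ d) + -coeffX d) + -coeffY (coeffX (coeffZ d) + coeffY d) =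
        coeffZ (coeffZ d) + d := by
      simp only [coeffX_coeffZ, coeffY_coeffZ, coeffX_coeffY, coeffX_add, coeffY_add, coeffX_neg]
      rw [← sub_eq_zero, ← neg_eq_zero, ← hPDE]
      abel
    rw [e₁, e₂, e₃]
  · intro x y
    refine evalSeries_eq_zero (fun j k => ?_) x y
    simp [coeffZ, hd, helmholtzCoeff]
  · intro x y
    simp only [hf, seriesField, h.coeffZ.coeffX.evalSeries_add h.coeffY, hY, add_zero]
    exact h.coeffZ.hasDerivAt_x x y 0
  · intro x y
    simp only [hf, seriesField, h.coeffZ.coeffY.evalSeries_add h.coeffX.neg, evalSeries_neg, hX,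
      neg_zero, add_zero]
    exact h.coeffZ.hasDerivAt_y x y 0

/-- Exponents of the monomial indexed by `j` in the expansion of a planar Gaussian. -/
def gaussExp (j : (ℕ × ℕ) × (ℕ × ℕ)) : ℕ × ℕ :=
  (2 * j.1.1 + j.1.2, 2 * j.2.1 + j.2.2)

/-- Coefficients of the expansion of `x ↦ exp (-(b * (x - s) ^ 2))` in powers of `x`. -/
noncomputable def gaussCoeff (b s : ℝ) (a : ℕ × ℕ) : ℝ :=
  Real.exp (-(b * s ^ 2)) * ((-b) ^ a.1 / a.1.factorial * ((2 * b * s) ^ a.2 / a.2.factorial))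

lemma hasSum_mul_prod {ι κ : Type} {f : ι → ℝ} {g : κ → ℝ} {a b : ℝ} (hf : HasSum f a)
    (hg : HasSum g b) (hf' : Summable fun i => |f i|) (hg' : Summable fun i => |g i|) :
    HasSum (fun q : ι × κ => f q.1 * g q.2) (a * b) := by
  have h : Summable fun q : ι × κ => f q.1 * g q.2 :=
    summable_mul_of_summable_norm (f := f) (g := g) hf' hg'
  exact HasSum.mul hf hg h

lemma hasSum_exp_mul_exp (u v : ℝ) :
    HasSum (fun a : ℕ × ℕ => u ^ a.1 / a.1.factorial * (v ^ a.2 / a.2.factorial))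
      (Real.exp u * Real.exp v) := by
  have h : ∀ u : ℝ, HasSum (fun n : ℕ => u ^ n / n.factorial) (Real.exp u) := fun u => by
    rw [Real.exp_eq_exp_ℝ]
    exact NormedSpace.expSeries_div_hasSum_exp (𝔸 := ℝ) u
  exact hasSum_mul_prod (h u) (h v) (h u).summable.abs (h v).summable.abs

lemma hasSum_const_mul_of_eq {ι : Type} {f g : ι → ℝ} {a b : ℝ} (c : ℝ) (h : HasSum f a)
    (hg : ∀ i, g i = c * f i) (hb : b = c * a) : HasSum g b := by
  rw [hb, show g = fun i => c * f i from funext hg]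
  exact h.mul_left c

lemma hasSum_gaussCoeff (b s x : ℝ) :
    HasSum (fun a : ℕ × ℕ => gaussCoeff b s a * x ^ (2 * a.1 + a.2))
      (Real.exp (-(b * (x - s) ^ 2))) := by
  refine hasSum_const_mul_of_eq (Real.exp (-(b * s ^ 2)))
    (hasSum_exp_mul_exp (-(b * x ^ 2)) (2 * b * s * x)) (fun a => ?_) ?_
  · rw [gaussCoeff, pow_add, pow_mul, mul_pow (2 * b * s) x, ← neg_mul, mul_pow]
    ring
  · rw [← Real.exp_add, ← Real.exp_add]
    congr 1; ring

lemma hasSum_abs_gaussCoeff {b : ℝ} (hb : 0 ≤ b) (R s : ℝ) :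
    HasSum (fun a : ℕ × ℕ => |gaussCoeff b s a| * R ^ (2 * a.1 + a.2))
      (Real.exp (b * (R ^ 2 + 2 * R * |s| - s ^ 2))) := by
  refine hasSum_const_mul_of_eq (Real.exp (-(b * s ^ 2)))
    (hasSum_exp_mul_exp (b * R ^ 2) (2 * b * |s| * R)) (fun a => ?_) ?_
  · rw [gaussCoeff, pow_add, pow_mul, mul_pow (2 * b * |s|) R, mul_pow b (R ^ 2)]
    simp only [abs_mul, abs_div, abs_pow, abs_neg, abs_of_nonneg hb, Nat.abs_cast, Real.abs_exp,
      abs_two]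
    ring
  · rw [← Real.exp_add, ← Real.exp_add]
    congr 1; ring

/-- Coefficients of the expansion of a planar Gaussian centred at `s`. -/
noncomputable def gaussCoeff₂ (b : ℝ) (s : ℝ × ℝ) (j : (ℕ × ℕ) × (ℕ × ℕ)) : ℝ :=
  gaussCoeff b s.1 j.1 * gaussCoeff b s.2 j.2

lemma hasSum_gaussCoeff₂ (b : ℝ) (hb : 0 ≤ b) (s p : ℝ × ℝ) :
    HasSum (fun j => gaussCoeff₂ b s j * (p.1 ^ (gaussExp j).1 * p.2 ^ (gaussExp j).2))
      (Real.exp (-(b * ((p.1 - s.1) ^ 2 + (p.2 - s.2) ^ 2)))) := by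
  have hn : ∀ s x : ℝ, Summable fun a : ℕ × ℕ => |gaussCoeff b s a * x ^ (2 * a.1 + a.2)| :=
    fun s x => by
      simpa [abs_mul, abs_pow] using (hasSum_abs_gaussCoeff hb |x| s).summable
  refine hasSum_const_mul_of_eq 1 (hasSum_mul_prod (hasSum_gaussCoeff b s.1 p.1)
    (hasSum_gaussCoeff b s.2 p.2) (hn _ _) (hn _ _)) (fun j => ?_) ?_
  · simp only [gaussCoeff₂, gaussExp]; ring
  · rw [one_mul, ← Real.exp_add]
    congr 1; ring

lemma hasSum_abs_gaussCoeff₂ {b : ℝ} (hb : 0 ≤ b) (R : ℝ) (s : ℝ × ℝ) :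
    HasSum (fun j => |gaussCoeff₂ b s j| * R ^ ((gaussExp j).1 + (gaussExp j).2))
      (Real.exp (b * (2 * R ^ 2 + 2 * R * (|s.1| + |s.2|) - (s.1 ^ 2 + s.2 ^ 2)))) := by
  have hn := fun s => hasSum_abs_gaussCoeff hb R s
  refine hasSum_const_mul_of_eq 1 (hasSum_mul_prod (hn s.1) (hn s.2) (hn s.1).summable.abs
    (hn s.2).summable.abs) (fun j => ?_) ?_
  · simp only [gaussCoeff₂, gaussExp, abs_mul, pow_add]; ring
  · rw [one_mul, ← Real.exp_add]
    congr 1; ring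

lemma continuous_gaussCoeff₂ (b : ℝ) (j) : Continuous fun s => gaussCoeff₂ b s j := by
  unfold gaussCoeff₂ gaussCoeff
  fun_prop

/-- Coefficients of the expansion of the convolution of `f` with a planar Gaussian. -/
noncomputable def smoothedCoeff (b : ℝ) (f : ℝ × ℝ → ℝ) (j : (ℕ × ℕ) × (ℕ × ℕ)) : ℝ :=
  ∫ s, f s * (b / Real.pi * gaussCoeff₂ b s j)

lemma integrable_mul_of_hasCompactSupport {f h : ℝ × ℝ → ℝ} (hf : Continuous f)
    (hc : HasCompactSupport f) (hh : Continuous h) : Integrable fun s => f s * h s :=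
  (hf.mul hh).integrable_of_hasCompactSupport hc.mul_right

lemma sum_integral_smoothedCoeff_le {f : ℝ × ℝ → ℝ} (hf : Continuous f)
    (hc : HasCompactSupport f) {b R : ℝ} (hb : 0 ≤ b) (hR : 0 ≤ R)
    (S : Finset ((ℕ × ℕ) × (ℕ × ℕ))) :
    ∑ j ∈ S, ∫ s, ‖f s * (b / Real.pi * gaussCoeff₂ b s j) *
        R ^ ((gaussExp j).1 + (gaussExp j).2)‖ ≤
      ∫ s, |f s| * (b / Real.pi *
        Real.exp (b * (2 * R ^ 2 + 2 * R * (|s.1| + |s.2|) - (s.1 ^ 2 + s.2 ^ 2)))) := by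
  have hπ : 0 ≤ b / Real.pi := by positivity
  have hcont := continuous_gaussCoeff₂ b
  rw [← integral_finsetSum]
  · refine integral_mono (integrable_finsetSum _ fun j _ => ?_) ?_ fun s => ?_
    · exact ((integrable_mul_of_hasCompactSupport hf hc
        (h := fun s => b / Real.pi * gaussCoeff₂ b s j) (by fun_prop)).mul_const _).norm
    · exact integrable_mul_of_hasCompactSupport hf.abs hc.norm (by fun_prop)
    · have h := sum_le_hasSum S (fun j _ => by positivity) (hasSum_abs_gaussCoeff₂ hb R s)
      calc ∑ j ∈ S, ‖f s * (b / Real.pi * gaussCoeff₂ b s j) *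
            R ^ ((gaussExp j).1 + (gaussExp j).2)‖
          = |f s| * (b / Real.pi * ∑ j ∈ S, |gaussCoeff₂ b s j| *
            R ^ ((gaussExp j).1 + (gaussExp j).2)) := by
            rw [Finset.mul_sum, Finset.mul_sum]
            refine Finset.sum_congr rfl fun j _ => ?_
            rw [Real.norm_eq_abs, abs_mul, abs_mul, abs_mul, abs_of_nonneg hπ,
              abs_of_nonneg (pow_nonneg hR _)]
            ring
        _ ≤ _ := by gcongr
  · exact fun j _ => ((integrable_mul_of_hasCompactSupport hf hc
        (h := fun s => b / Real.pi * gaussCoeff₂ b s j) (by fun_prop)).mul_const _).norm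

lemma abs_smoothedCoeff_mul_le {f : ℝ × ℝ → ℝ} {b R : ℝ} (hR : 0 ≤ R) (j) :
    |smoothedCoeff b f j| * R ^ ((gaussExp j).1 + (gaussExp j).2) ≤
      ∫ s, ‖f s * (b / Real.pi * gaussCoeff₂ b s j) *
        R ^ ((gaussExp j).1 + (gaussExp j).2)‖ := by
  refine le_trans (le_of_eq ?_) (norm_integral_le_integral_norm _)
  rw [integral_mul_const, Real.norm_eq_abs, abs_mul, abs_of_nonneg (pow_nonneg hR _)]
  rfl

lemma summable_smoothedCoeff {f : ℝ × ℝ → ℝ} (hf : Continuous f)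
    (hc : HasCompactSupport f) {b R : ℝ} (hb : 0 ≤ b) (hR : 0 ≤ R) :
    Summable fun j => |smoothedCoeff b f j| * R ^ ((gaussExp j).1 + (gaussExp j).2) :=
  summable_of_sum_le (fun _ => by positivity) fun S =>
    (Finset.sum_le_sum fun j _ => abs_smoothedCoeff_mul_le hR j).trans
      (sum_integral_smoothedCoeff_le hf hc hb hR S)

lemma tsum_smoothedCoeff_le {f : ℝ × ℝ → ℝ} (hf : Continuous f)
    (hc : HasCompactSupport f) {b R : ℝ} (hb : 0 ≤ b) (hR : 0 ≤ R) :
    ∑' j, |smoothedCoeff b f j| * R ^ ((gaussExp j).1 + (gaussExp j).2) ≤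
      ∫ s, |f s| * (b / Real.pi *
        Real.exp (b * (2 * R ^ 2 + 2 * R * (|s.1| + |s.2|) - (s.1 ^ 2 + s.2 ^ 2)))) :=
  (summable_smoothedCoeff hf hc hb hR).tsum_le_of_sum_le fun S =>
    (Finset.sum_le_sum fun j _ => abs_smoothedCoeff_mul_le hR j).trans
      (sum_integral_smoothedCoeff_le hf hc hb hR S)

/-- The planar Gaussian probability density with parameter `b`. -/
noncomputable def gaussKernel (b : ℝ) (v : ℝ × ℝ) : ℝ :=
  b / Real.pi * Real.exp (-(b * (v.1 ^ 2 + v.2 ^ 2)))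

lemma hasSum_smoothedCoeff {f : ℝ × ℝ → ℝ} (hf : Continuous f)
    (hc : HasCompactSupport f) {b : ℝ} (hb : 0 ≤ b) (p : ℝ × ℝ) :
    HasSum (fun j => smoothedCoeff b f j * (p.1 ^ (gaussExp j).1 * p.2 ^ (gaussExp j).2))
      (∫ s, f s * gaussKernel b (p - s)) := by
  have hcont := continuous_gaussCoeff₂ b
  set R := |p.1| + |p.2| with hR
  have hR0 : 0 ≤ R := by positivity
  have h := hasSum_integral_of_summable_integral_norm (μ := volume)
    (F := fun j s => f s * (b / Real.pi * gaussCoeff₂ b s j) *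
      (p.1 ^ (gaussExp j).1 * p.2 ^ (gaussExp j).2))
    (fun j => (integrable_mul_of_hasCompactSupport hf hc
        (h := fun s => b / Real.pi * gaussCoeff₂ b s j) (by fun_prop)).mul_const _)
    (by
      refine Summable.of_nonneg_of_le (fun j => integral_nonneg fun _ => norm_nonneg _)
        (fun j => ?_) (summable_of_sum_le (fun j => integral_nonneg fun _ => norm_nonneg _)
          (sum_integral_smoothedCoeff_le hf hc hb hR0))
      refine integral_mono ?_ ?_ fun s => ?_
      · exact ((integrable_mul_of_hasCompactSupport hf hc
          (h := fun s => b / Real.pi * gaussCoeff₂ b s j) (by fun_prop)).mul_const _).norm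
      · exact ((integrable_mul_of_hasCompactSupport hf hc
          (h := fun s => b / Real.pi * gaussCoeff₂ b s j) (by fun_prop)).mul_const _).norm
      · simp only [norm_mul]
        gcongr
        rw [norm_pow, norm_pow, norm_pow, pow_add, Real.norm_of_nonneg hR0]
        gcongr <;> simp [hR])
  refine hasSum_const_mul_of_eq 1 h (fun j => ?_) ?_
  · rw [one_mul, integral_mul_const]; rfl
  · rw [one_mul]
    refine integral_congr_ae (Eventually.of_forall fun s => ?_)
    have h2 := ((hasSum_gaussCoeff₂ b hb s p).mul_left (f s * (b / Real.pi))).tsum_eq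
    simp only [gaussKernel, Prod.fst_sub, Prod.snd_sub]
    rw [← mul_assoc, ← h2]
    exact tsum_congr fun j => by ring

lemma gaussKernel_eq (b : ℝ) : gaussKernel b = fun v : ℝ × ℝ =>
    b / Real.pi * (Real.exp (-b * v.1 ^ 2) * Real.exp (-b * v.2 ^ 2)) := by
  funext v
  rw [gaussKernel, ← Real.exp_add]
  congr 2; ring

lemma continuous_gaussKernel (b : ℝ) : Continuous (gaussKernel b) := by
  unfold gaussKernel; fun_prop

lemma gaussKernel_nonneg {b : ℝ} (hb : 0 ≤ b) (v : ℝ × ℝ) : 0 ≤ gaussKernel b v := by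
  unfold gaussKernel; positivity

lemma integrable_gaussKernel {b : ℝ} (hb : 0 < b) : Integrable (gaussKernel b) := by
  rw [gaussKernel_eq]
  exact ((integrable_exp_neg_mul_sq hb).mul_prod (integrable_exp_neg_mul_sq hb)).const_mul _

lemma integral_gaussKernel {b : ℝ} (hb : 0 < b) : ∫ v, gaussKernel b v = 1 := by
  have h : ∫ v : ℝ × ℝ, Real.exp (-b * v.1 ^ 2) * Real.exp (-b * v.2 ^ 2) =
      √(Real.pi / b) * √(Real.pi / b) := by
    rw [Measure.volume_eq_prod, integral_prod_mul (fun x : ℝ => Real.exp (-b * x ^ 2))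
      (fun x : ℝ => Real.exp (-b * x ^ 2)), integral_gaussian]
  rw [gaussKernel_eq, integral_const_mul, h, Real.mul_self_sqrt (by positivity)]
  field_simp

lemma gaussKernel_mul_norm_le {M : ℝ} (hM : 0 < M) (v : ℝ × ℝ) :
    gaussKernel (M ^ 2) v * ‖v‖ ≤ 2 / M * gaussKernel (M ^ 2 / 2) v := by
  have h1 : ‖v‖ ^ 2 ≤ v.1 ^ 2 + v.2 ^ 2 := by
    rcases max_choice ‖v.1‖ ‖v.2‖ with h | h <;>
    · rw [Prod.norm_def, h, Real.norm_eq_abs, sq_abs]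
      nlinarith [sq_nonneg v.1, sq_nonneg v.2]
  have h2 : M * ‖v‖ ≤ Real.exp (M ^ 2 / 2 * (v.1 ^ 2 + v.2 ^ 2)) := by
    have h3 := Real.add_one_le_exp (M ^ 2 / 2 * (v.1 ^ 2 + v.2 ^ 2))
    nlinarith [sq_nonneg (M * ‖v‖ - 1), mul_le_mul_of_nonneg_left h1 (sq_nonneg M)]
  have h4 : Real.exp (-(M ^ 2 / 2 * (v.1 ^ 2 + v.2 ^ 2))) =
      Real.exp (-(M ^ 2 * (v.1 ^ 2 + v.2 ^ 2))) *
        Real.exp (M ^ 2 / 2 * (v.1 ^ 2 + v.2 ^ 2)) := by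
    rw [← Real.exp_add]; congr 1; ring
  rw [gaussKernel, gaussKernel, h4]
  calc M ^ 2 / Real.pi * Real.exp (-(M ^ 2 * (v.1 ^ 2 + v.2 ^ 2))) * ‖v‖
      = M / Real.pi * Real.exp (-(M ^ 2 * (v.1 ^ 2 + v.2 ^ 2))) * (M * ‖v‖) := by ring
    _ ≤ M / Real.pi * Real.exp (-(M ^ 2 * (v.1 ^ 2 + v.2 ^ 2))) *
        Real.exp (M ^ 2 / 2 * (v.1 ^ 2 + v.2 ^ 2)) := by gcongr
    _ = _ := by field_simp

lemma exists_hasFDerivAt_smoothed {f : ℝ × ℝ → ℝ} (hf : ContDiff ℝ 2 f)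
    (hc : HasCompactSupport f) {L : NNReal} (hL : LipschitzWith L (fderiv ℝ f)) {M : ℝ}
    (hM : 0 < M) (p : ℝ × ℝ) :
    ∃ g' : ℝ × ℝ →L[ℝ] ℝ, HasFDerivAt (fun p => ∫ s, f s * gaussKernel (M ^ 2) (p - s)) g' p ∧
      ‖g' - fderiv ℝ f p‖ ≤ L * (2 / M) := by
  have hM2 : 0 < M ^ 2 := by positivity
  set K := gaussKernel (M ^ 2) with hK
  have hKi : Integrable K := integrable_gaussKernel hM2
  have hKc : Continuous K := continuous_gaussKernel _
  have h := hc.hasFDerivAt_convolution_right (μ := volume) (ContinuousLinearMap.lsmul ℝ ℝ)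
    hKi.locallyIntegrable (hf.of_le (by norm_num)) p
  have hder : Continuous (fderiv ℝ f) := hf.continuous_fderiv (by norm_num)
  have e1 : convolution K f (ContinuousLinearMap.lsmul ℝ ℝ) volume =
      fun p => ∫ s, f s * K (p - s) := by
    funext p
    rw [convolution_lsmul, ← integral_sub_left_eq_self _ volume p]
    refine integral_congr_ae (Eventually.of_forall fun s => ?_)
    simp [mul_comm]
  have e2 : convolution K (fderiv ℝ f)
      (ContinuousLinearMap.precompR (ℝ × ℝ) (ContinuousLinearMap.lsmul ℝ ℝ)) volume p =
      ∫ t, K t • fderiv ℝ f (p - t) := by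
    rw [convolution_def]
    refine integral_congr_ae (Eventually.of_forall fun s => ?_)
    ext <;> rfl
  rw [e1, e2] at h
  refine ⟨_, h, ?_⟩
  obtain ⟨B, hB⟩ := (hc.fderiv (𝕜 := ℝ)).exists_bound_of_continuous hder
  have hi1 : Integrable fun t => K t • fderiv ℝ f (p - t) :=
    hKi.smul_bdd B (hder.comp (by fun_prop)).aestronglyMeasurable
      (Eventually.of_forall fun t => hB _)
  have hi2 : Integrable fun t => K t • fderiv ℝ f p := hKi.smul_const _
  have e3 : fderiv ℝ f p = ∫ t, K t • fderiv ℝ f p := by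
    rw [integral_smul_const, integral_gaussKernel hM2, one_smul]
  rw [e3, ← integral_sub hi1 hi2]
  calc ‖∫ t, K t • fderiv ℝ f (p - t) - K t • fderiv ℝ f p‖
      ≤ ∫ t, L * (2 / M) * gaussKernel (M ^ 2 / 2) t := by
        refine norm_integral_le_of_norm_le ((integrable_gaussKernel (by positivity)).const_mul _)
          (Eventually.of_forall fun t => ?_)
        have h0 : K t • fderiv ℝ f (p - t) - K t • fderiv ℝ f p =
            K t • (fderiv ℝ f (p - t) - fderiv ℝ f p) := (smul_sub _ _ _).symm
        rw [h0, norm_smul, Real.norm_of_nonneg (gaussKernel_nonneg hM2.le t)]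
        have h1 := hL.dist_le_mul (p - t) p
        rw [dist_eq_norm, dist_eq_norm, sub_sub_cancel_left, norm_neg] at h1
        calc K t * ‖fderiv ℝ f (p - t) - fderiv ℝ f p‖ ≤ K t * (L * ‖t‖) := by
              gcongr; exact gaussKernel_nonneg hM2.le t
          _ = L * (K t * ‖t‖) := by ring
          _ ≤ L * (2 / M * gaussKernel (M ^ 2 / 2) t) :=
              mul_le_mul_of_nonneg_left (gaussKernel_mul_norm_le hM t) L.2
          _ = _ := by ring
    _ = L * (2 / M) := by rw [integral_const_mul, integral_gaussKernel (by positivity), mul_one]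

lemma tsum_smoothedCoeff_le_of_eq_zero {f : ℝ × ℝ → ℝ} (hf : Continuous f)
    (hc : HasCompactSupport f) {b R : ℝ} (hb : 0 < b) (hR : 1 ≤ R)
    (hfR : ∀ s, ‖s‖ ≤ 4 * R → f s = 0) :
    ∑' j, |smoothedCoeff b f j| * R ^ ((gaussExp j).1 + (gaussExp j).2) ≤ (∫ s, |f s|) / b := by
  refine (tsum_smoothedCoeff_le hf hc hb.le (by linarith)).trans ?_
  rw [← integral_div]
  refine integral_mono (integrable_mul_of_hasCompactSupport hf.abs hc.norm (by fun_prop))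
    ((hf.abs.integrable_of_hasCompactSupport hc.norm).div_const b) fun s => ?_
  simp only
  rw [div_eq_mul_inv]
  by_cases hs : ‖s‖ ≤ 4 * R
  · simp [hfR s hs]
  push Not at hs
  refine mul_le_mul_of_nonneg_left ?_ (abs_nonneg _)
  have h1 : 2 * R ^ 2 + 2 * R * (|s.1| + |s.2|) - (s.1 ^ 2 + s.2 ^ 2) ≤ -2 := by
    rw [← sq_abs s.1, ← sq_abs s.2]
    rw [Prod.norm_def] at hs
    rcases lt_max_iff.1 hs with h | h <;> rw [Real.norm_eq_abs] at h
    · nlinarith [sq_nonneg (|s.2| - R), mul_pos (sub_pos.2 h) (sub_pos.2 h)]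
    · nlinarith [sq_nonneg (|s.1| - R), mul_pos (sub_pos.2 h) (sub_pos.2 h)]
  have h2 : b ≤ Real.exp b := by linarith [Real.add_one_le_exp b]
  calc b / Real.pi * Real.exp (b * (2 * R ^ 2 + 2 * R * (|s.1| + |s.2|) - (s.1 ^ 2 + s.2 ^ 2)))
      ≤ b / 1 * Real.exp (b * -2) := by
        gcongr
        linarith [Real.pi_gt_three]
    _ ≤ b⁻¹ := by
        rw [div_one, show b * -2 = -(b + b) by ring, Real.exp_neg, Real.exp_add, mul_inv,
          ← mul_assoc]
        have h3 : b * (Real.exp b)⁻¹ ≤ 1 := by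
          rw [← div_eq_mul_inv]; exact div_le_one_of_le₀ h2 (Real.exp_pos b).le
        calc b * (Real.exp b)⁻¹ * (Real.exp b)⁻¹ ≤ 1 * b⁻¹ := by gcongr
          _ = b⁻¹ := one_mul _

/-- A compactly supported function is approximated, together with its gradient, by an entire
function whose expansion is small on a ball well inside the zero set. -/
lemma exists_entire_approx {f : ℝ × ℝ → ℝ} (hf : ContDiff ℝ 2 f) (hc : HasCompactSupport f)
    {δ : ℝ} (hδ : 0 < δ) (R : ℝ) (hfR : ∀ s, ‖s‖ ≤ 4 * R → f s = 0) :
    ∃ (w : (ℕ × ℕ) × (ℕ × ℕ) → ℝ) (g : ℝ × ℝ → ℝ) (g' : ℝ × ℝ → ℝ × ℝ →L[ℝ] ℝ),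
      (∀ r : ℝ, 0 ≤ r → Summable fun j => |w j| * r ^ ((gaussExp j).1 + (gaussExp j).2)) ∧
      (∀ p : ℝ × ℝ, HasSum (fun j => w j * (p.1 ^ (gaussExp j).1 * p.2 ^ (gaussExp j).2)) (g p)) ∧
      (∀ p, HasFDerivAt g (g' p) p) ∧ (∀ p, ‖g' p - fderiv ℝ f p‖ ≤ δ) ∧
      (1 ≤ R → ∑' j, |w j| * R ^ ((gaussExp j).1 + (gaussExp j).2) ≤ δ) := by
  obtain ⟨L, hL⟩ := ContDiff.lipschitzWith_of_hasCompactSupport (hc.fderiv (𝕜 := ℝ))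
    (hf.fderiv_right (m := 1) (by norm_num)) one_ne_zero
  set A := ∫ s, |f s| with hA
  have hA0 : 0 ≤ A := integral_nonneg fun _ => abs_nonneg _
  set M : ℝ := 1 + (2 * L + A) / δ with hM
  have hM1 : 1 ≤ M := by rw [hM]; simp; positivity
  have hMδ : 2 * L + A ≤ M * δ := by rw [hM, add_mul, div_mul_cancel₀ _ hδ.ne']; linarith
  have hM0 : 0 < M := by linarith
  choose g' hg' using fun p => exists_hasFDerivAt_smoothed hf hc hL hM0 p
  refine ⟨smoothedCoeff (M ^ 2) f, _, g',
    fun r hr => summable_smoothedCoeff hf.continuous hc (by positivity) hr,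
    fun p => hasSum_smoothedCoeff hf.continuous hc (by positivity) p, fun p => (hg' p).1,
    fun p => (hg' p).2.trans ?_, fun hR =>
      (tsum_smoothedCoeff_le_of_eq_zero hf.continuous hc (by positivity) hR hfR).trans ?_⟩
  · rw [← mul_div_assoc, div_le_iff₀ hM0]; linarith
  · rw [div_le_iff₀ (by positivity)]
    have : (0 : ℝ) ≤ L := L.2
    nlinarith [mul_le_mul_of_nonneg_right hM1 (mul_pos hM0 hδ).le]

lemma tsum_smul_fiber {ι κ : Type} (w m : ι → ℝ) (e : ι → κ) (m' : κ → ℝ) (hm : ∀ j, m j = m' (e j))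
    {a : ℝ} (h : HasSum (fun j => w j * m j) a) :
    ∑' q : κ, (∑' j : ↑(e ⁻¹' {q}), w j) * m' q = a := by
  rw [← (h.tsum_fiberwise e).tsum_eq]
  refine tsum_congr fun q => ?_
  rw [← tsum_mul_right]
  refine tsum_congr fun j => ?_
  have hj : e j = q := j.2
  rw [hm, hj]

lemma abs_tsum_fiber_mul_le {ι κ : Type} {w : ι → ℝ} (hw : Summable fun j => |w j|) (e : ι → κ)
    (d : κ → ℕ) {r : ℝ} (hr : 0 ≤ r) (h : Summable fun j => |w j| * r ^ d (e j)) (q : κ) :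
    |∑' j : ↑(e ⁻¹' {q}), w j| * r ^ d q ≤ ∑' j, |w j| * r ^ d (e j) := by
  have h1 : Summable fun j : ↑(e ⁻¹' {q}) => |w j| := hw.subtype _
  calc |∑' j : ↑(e ⁻¹' {q}), w j| * r ^ d q ≤ (∑' j : ↑(e ⁻¹' {q}), |w j|) * r ^ d q := by
        gcongr
        have := norm_tsum_le_tsum_norm (f := fun j : ↑(e ⁻¹' {q}) => w j) h1
        simpa using this
    _ = ∑' j : ↑(e ⁻¹' {q}), |w j| * r ^ d (e j) := by
        rw [← tsum_mul_right]
        refine tsum_congr fun j => ?_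
        have hj : e j = q := j.2
        rw [hj]
    _ ≤ ∑' j, |w j| * r ^ d (e j) :=
        h.tsum_subtype_le (fun j => |w j| * r ^ d (e j)) _ (fun j => by positivity)

/-- Simultaneous approximation of a locally finite sum of compactly supported functions,
in the uniform norm of the gradient, by an entire function. -/
theorem exists_entire_potential {ι : Type} [Countable ι] (f : ι → ℝ × ℝ → ℝ) (R : ι → ℝ)
    (hf : ∀ n, ContDiff ℝ 2 (f n)) (hc : ∀ n, HasCompactSupport (f n))
    (hfR : ∀ n s, ‖s‖ ≤ 4 * R n → f n s = 0) (hR : ∀ r, {n | R n ≤ r}.Finite) {η : ℝ}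
    (hη : 0 < η) :
    ∃ c : ℕ → ℕ → ℝ, (∀ r : ℝ, 0 ≤ r → ∃ C, ∀ j k, |c j k| * r ^ (j + k) ≤ C) ∧
      ∃ F' : ℝ × ℝ → ℝ × ℝ →L[ℝ] ℝ, ∀ p,
        HasFDerivAt (fun p : ℝ × ℝ => ∑' q : ℕ × ℕ, c q.1 q.2 * (p.1 ^ q.1 * p.2 ^ q.2)) (F' p) p ∧
        ‖F' p - ∑' n, fderiv ℝ (f n) p‖ ≤ η := by
  obtain ⟨δ', hδ', D, hD, hDη⟩ := NNReal.exists_pos_sum_of_countable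
    (ε := ⟨η, hη.le⟩) (fun h => hη.ne' (congrArg NNReal.toReal h)) ι
  set δ : ι → ℝ := fun n => δ' n with hδdef
  have hδ : ∀ n, 0 < δ n := fun n => hδ' n
  have hDs : HasSum δ D := NNReal.hasSum_coe.2 hD
  have hDη : (D : ℝ) ≤ η := hDη.le
  choose w g g' hw hwg hgg' hg'δ hwδ using fun n =>
    exists_entire_approx (hf n) (hc n) (hδ n) (R n) (hfR n)
  set e : ι × ((ℕ × ℕ) × (ℕ × ℕ)) → ℕ × ℕ := fun j => gaussExp j.2 with he
  set W : ι × ((ℕ × ℕ) × (ℕ × ℕ)) → ℝ := fun j => w j.1 j.2 with hWdef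
  have hW : ∀ r : ℝ, 0 ≤ r → Summable fun j => |W j| * r ^ ((e j).1 + (e j).2) := by
    intro r hr
    refine (summable_prod_of_nonneg fun j => by positivity).2 ⟨fun n => hw n r hr, ?_⟩
    refine Summable.of_norm_bounded_eventually hDs.summable ?_
    have hfin := hR (max r 1)
    filter_upwards [hfin.compl_mem_cofinite] with n hn
    have hn' : max r 1 < R n := by simpa using hn
    rw [Real.norm_of_nonneg (tsum_nonneg fun j => by positivity)]
    refine le_trans ?_ (hwδ n ((le_max_right _ _).trans hn'.le))
    refine (hw n r hr).tsum_le_tsum (fun j => ?_) (hw n _ (hr.trans ((le_max_left _ _).trans hn'.le)))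
    have := (le_max_left r 1).trans hn'.le
    gcongr
  have hW1 : Summable fun j => |W j| := by simpa using hW 1 zero_le_one
  have hpt : ∀ p : ℝ × ℝ, Summable fun j => W j * (p.1 ^ (e j).1 * p.2 ^ (e j).2) := by
    intro p
    refine Summable.of_norm_bounded (hW (|p.1| + |p.2|) (by positivity)) fun j => ?_
    rw [Real.norm_eq_abs, abs_mul, abs_mul, abs_pow, abs_pow, pow_add]
    gcongr <;> simp
  have hgs : ∀ p : ℝ × ℝ, HasSum (fun n => g n p)
      (∑' j, W j * (p.1 ^ (e j).1 * p.2 ^ (e j).2)) := fun p =>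
    (hpt p).hasSum.prod_fiberwise fun n => hwg n p
  set c : ℕ → ℕ → ℝ := fun j k => ∑' i : ↑(e ⁻¹' {(j, k)}), W i with hcdef
  have hsum : ∀ p : ℝ × ℝ, ∑' q : ℕ × ℕ, c q.1 q.2 * (p.1 ^ q.1 * p.2 ^ q.2) = ∑' n, g n p := by
    intro p
    rw [(hgs p).tsum_eq]
    exact tsum_smul_fiber W _ e (fun q => p.1 ^ q.1 * p.2 ^ q.2) (fun _ => rfl) (hpt p).hasSum
  refine ⟨c, fun r hr => ⟨_, fun j k => abs_tsum_fiber_mul_le hW1 e (fun q => q.1 + q.2) hr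
    (hW r hr) (j, k)⟩, fun p => ∑' n, g' n p, fun p => ⟨?_, ?_⟩⟩
  · simp only [hsum]
    choose B hB using fun n => ((hc n).fderiv (𝕜 := ℝ)).exists_bound_of_continuous
      ((hf n).continuous_fderiv (by norm_num))
    set r := ‖p‖ + 1 with hr
    have hr0 : 0 < r := by positivity
    classical
    refine hasFDerivAt_tsum_of_isPreconnected (s := Metric.ball (0 : ℝ × ℝ) r) (x₀ := 0)
      (u := fun n => δ n + if R n ≤ r then B n else 0) ?_ Metric.isOpen_ball
      (convex_ball _ _).isPreconnected (fun n x _ => hgg' n x) (fun n x hx => ?_)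
      (by simpa using hr0) (hgs 0).summable (by simp [hr])
    · refine hDs.summable.add (summable_of_hasFiniteSupport ((hR r).subset fun n hn => ?_))
      by_contra h
      exact hn (if_neg h)
    · have h1 : ‖g' n x‖ ≤ δ n + ‖fderiv ℝ (f n) x‖ := by
        calc ‖g' n x‖ = ‖(g' n x - fderiv ℝ (f n) x) + fderiv ℝ (f n) x‖ := by rw [sub_add_cancel]
          _ ≤ _ := (norm_add_le _ _).trans (by gcongr; exact hg'δ n x)
      refine h1.trans ?_
      gcongr
      split_ifs with h
      · exact hB n x
      · push Not at h
        have hev : f n =ᶠ[𝓝 x] fun _ => 0 := by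
          filter_upwards [Metric.isOpen_ball.mem_nhds hx] with s hs
          have := mem_ball_zero_iff.1 hs
          exact hfR n s (by linarith)
        rw [hev.fderiv_eq]; simp
  · have hfin : Summable fun n => fderiv ℝ (f n) p := by
      refine summable_of_hasFiniteSupport ((hR (‖p‖ + 1)).subset fun n hn => ?_)
      by_contra h
      simp only [Set.mem_ofPred_eq, not_le] at h
      refine hn ?_
      have hev : f n =ᶠ[𝓝 p] fun _ => 0 := by
        filter_upwards [Metric.isOpen_ball.mem_nhds (Metric.mem_ball_self zero_lt_one)] with s hs
        have h2 : ‖s‖ ≤ ‖p‖ + 1 := by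
          have := norm_sub_norm_le s p
          have h3 := mem_ball_iff_norm.1 hs
          linarith
        exact hfR n s (by nlinarith [norm_nonneg p])
      show fderiv ℝ (f n) p = 0
      rw [hev.fderiv_eq]; simp
    have hdiff : Summable fun n => g' n p - fderiv ℝ (f n) p :=
      Summable.of_norm_bounded hDs.summable fun n => hg'δ n p
    have hg's : Summable fun n => g' n p := by simpa using hdiff.add hfin
    rw [← hg's.tsum_sub hfin]
    exact (tsum_of_norm_bounded hDs fun n => hg'δ n p).trans hDη

/-- A `C²` function on the plane can be approximated, uniformly together with its first
derivatives, by the sum of an everywhere convergent power series. -/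
theorem exists_entire_potential_of_contDiff {H : ℝ × ℝ → ℝ} (hH : ContDiff ℝ 2 H) {η : ℝ}
    (hη : 0 < η) :
    ∃ c : ℕ → ℕ → ℝ, (∀ r : ℝ, 0 ≤ r → ∃ C, ∀ j k, |c j k| * r ^ (j + k) ≤ C) ∧
      ∃ F' : ℝ × ℝ → ℝ × ℝ →L[ℝ] ℝ, ∀ p,
        HasFDerivAt (fun p : ℝ × ℝ => ∑' q : ℕ × ℕ, c q.1 q.2 * (p.1 ^ q.1 * p.2 ^ q.2)) (F' p) p ∧
        ‖F' p - fderiv ℝ H p‖ ≤ η := by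
  set N : ℝ × ℝ → ℝ := fun p => p.1 ^ 2 + p.2 ^ 2 with hN
  have hNc : ContDiff ℝ 2 N := (contDiff_fst.pow 2).add (contDiff_snd.pow 2)
  set χ : ℕ → ℝ × ℝ → ℝ := fun k p =>
    Real.smoothTransition (N p - k + 2) - Real.smoothTransition (N p - (k + 1 : ℕ) + 2) with hχ
  have hST : ContDiff ℝ 2 Real.smoothTransition := Real.smoothTransition.contDiff
  have hχc : ∀ k, ContDiff ℝ 2 (χ k) := fun k =>
    (hST.comp ((hNc.sub contDiff_const).add contDiff_const)).sub
      (hST.comp ((hNc.sub contDiff_const).add contDiff_const))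
  set f : ℕ → ℝ × ℝ → ℝ := fun k p => χ k p * H p with hf
  have hfc : ∀ k, ContDiff ℝ 2 (f k) := fun k => (hχc k).mul hH
  have hin : ∀ (k : ℕ) p, N p ≤ k - 2 → f k p = 0 := by
    intro k p hp
    have : χ k p = 0 := by
      simp only [hχ]
      rw [Real.smoothTransition.zero_of_nonpos (by linarith),
        Real.smoothTransition.zero_of_nonpos (by push_cast; linarith), sub_zero]
    simp only [hf, this, zero_mul]
  have hout : ∀ (k : ℕ) p, (k : ℝ) ≤ N p → f k p = 0 := by
    intro k p hp
    have : χ k p = 0 := by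
      simp only [hχ]
      rw [Real.smoothTransition.one_of_one_le (by linarith),
        Real.smoothTransition.one_of_one_le (by push_cast; linarith), sub_self]
    simp only [hf, this, zero_mul]
  have hNn : ∀ p, N p ≤ 2 * ‖p‖ ^ 2 := by
    intro p
    have h1 : |p.1| ≤ ‖p‖ := norm_fst_le p
    have h2 : |p.2| ≤ ‖p‖ := norm_snd_le p
    have h1' := pow_le_pow_left₀ (abs_nonneg _) h1 2
    have h2' := pow_le_pow_left₀ (abs_nonneg _) h2 2
    rw [sq_abs] at h1' h2'
    simp only [hN]; linarith
  have hsupp : ∀ k, HasCompactSupport (f k) := by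
    intro k
    refine HasCompactSupport.intro (isCompact_closedBall (0 : ℝ × ℝ) (k + 1)) fun p hp => ?_
    refine hout k p ?_
    rw [mem_closedBall_zero_iff, not_le, Prod.norm_def, lt_max_iff] at hp
    have hk : (0 : ℝ) ≤ k := k.cast_nonneg
    have key : ∀ a : ℝ, (k : ℝ) + 1 < |a| → (k : ℝ) ≤ a ^ 2 := by
      intro a ha
      rw [← sq_abs]; nlinarith
    simp only [hN]
    rcases hp with hp | hp
    · nlinarith [key _ hp, sq_nonneg p.2]
    · nlinarith [key _ hp, sq_nonneg p.1]
  obtain ⟨c, hc, F', hF'⟩ := exists_entire_potential f (fun k => √((k : ℝ) / 32) - 1) hfc hsupp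
    (fun k s hs => by
      refine hin k s ?_
      have hw : √((k : ℝ) / 32) ^ 2 = (k : ℝ) / 32 := Real.sq_sqrt (by positivity)
      have h1 := pow_le_pow_left₀ (norm_nonneg _) hs 2
      have h0 := norm_nonneg s
      have := hNn s
      nlinarith)
    (fun r => by
      refine (Set.finite_Iic ⌈32 * (r + 1) ^ 2⌉₊).subset fun k hk => ?_
      have hk' : √((k : ℝ) / 32) ≤ r + 1 := by
        simp only [Set.mem_ofPred_eq] at hk; linarith
      have hw : √((k : ℝ) / 32) ^ 2 = (k : ℝ) / 32 := Real.sq_sqrt (by positivity)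
      have h1 := pow_le_pow_left₀ (Real.sqrt_nonneg _) hk' 2
      rw [hw] at h1
      have : (k : ℝ) ≤ ⌈32 * (r + 1) ^ 2⌉₊ := le_trans (by linarith) (Nat.le_ceil _)
      exact_mod_cast this)
    hη
  refine ⟨c, hc, F', fun p => ⟨(hF' p).1, ?_⟩⟩
  have hsum : ∑' k, fderiv ℝ (f k) p = fderiv ℝ H p := by
    set K : ℕ := ⌈N p⌉₊ + 3 with hK
    have hKp : N p < K - 2 := by
      rw [hK]; push_cast; linarith [Nat.le_ceil (N p)]
    have hev : ∀ᶠ s in 𝓝 p, N s < K - 2 :=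
      hNc.continuous.continuousAt.eventually_lt continuousAt_const hKp
    rw [tsum_eq_sum (s := Finset.range K)]
    · rw [← fderiv_fun_sum fun k _ => ((hfc k).differentiable (by norm_num)) p]
      refine Filter.EventuallyEq.fderiv_eq ?_
      filter_upwards [hev] with s hs
      have hNs : 0 ≤ N s := by simp only [hN]; positivity
      simp only [hf]
      rw [← Finset.sum_mul]
      have := Finset.sum_range_sub' (fun k : ℕ => Real.smoothTransition (N s - k + 2)) K
      simp only [hχ]
      rw [this, Real.smoothTransition.one_of_one_le (by simp; linarith),
        Real.smoothTransition.zero_of_nonpos (by linarith), sub_zero, one_mul]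
    · intro k hk
      have hk' : (K : ℝ) ≤ k := by exact_mod_cast not_lt.1 fun h => hk (Finset.mem_range.2 h)
      have : f k =ᶠ[𝓝 p] fun _ => 0 := by
        filter_upwards [hev] with s hs
        exact hin k s (by linarith)
      rw [this.fderiv_eq]; simp
  rw [← hsum]
  exact (hF' p).2

/-- A bounded, locally Lipschitz vector field on a proper space has global integral curves. -/
theorem LocallyLipschitz.exists_forall_hasDerivAt {E : Type*} [NormedAddCommGroup E]
    [NormedSpace ℝ E] [ProperSpace E] {Y : E → E} (hY : LocallyLipschitz Y) {L : ℝ}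
    (hL : ∀ p, ‖Y p‖ ≤ L) (p₀ : E) :
    ∃ γ : ℝ → E, γ 0 = p₀ ∧ ∀ t, HasDerivAt γ (Y (γ t)) t := by
  have hL0 : 0 ≤ L := (norm_nonneg _).trans (hL p₀)
  have hex : ∀ n : ℕ, ∃ α : ℝ → E, α 0 = p₀ ∧
      ∀ t ∈ Ioo (-(n : ℝ)) n, HasDerivAt α (Y (α t)) t := by
    intro n
    obtain ⟨K, hK⟩ := (hY.locallyLipschitzOn
      (s := Metric.closedBall p₀ (L * n))).exists_lipschitzOnWith_of_compact
        (isCompact_closedBall _ _)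
    have hpl : IsPicardLindelof (fun _ => Y) (tmin := -(n : ℝ)) (tmax := n)
        ⟨0, by simp⟩ p₀ ⟨L * n, by positivity⟩ 0 ⟨L, hL0⟩ K :=
      .of_time_independent (fun p _ => hL p) hK (by
        change L * max ((n : ℝ) - 0) (0 - -n) ≤ L * n - 0
        simp)
    obtain ⟨α, h0, hα⟩ := hpl.exists_eq_forall_mem_Icc_hasDerivWithinAt₀
    exact ⟨α, h0, fun t ht => (hα t (Ioo_subset_Icc_self ht)).hasDerivAt (Icc_mem_nhds ht.1 ht.2)⟩
  choose α h0 hα using hex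
  have huniq : ∀ n k : ℕ, ∀ t : ℝ, |t| < n → |t| < k → α n t = α k t := by
    intro n k t hn hk
    set a : ℝ := (|t| + min (n : ℝ) k) / 2 with ha
    have hmin : |t| < min (n : ℝ) k := lt_min hn hk
    have hta : |t| < a := by rw [ha]; linarith
    have hak : a < k := (by rw [ha]; linarith : a < min (n : ℝ) k).trans_le (min_le_right _ _)
    have han : a < n := (by rw [ha]; linarith : a < min (n : ℝ) k).trans_le (min_le_left _ _)
    have hc : ∀ j : ℕ, a < j → IsCompact (α j '' Icc (-a) a) := fun j hj =>
      isCompact_Icc.image_of_continuousOn fun s hs =>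
        (hα j s ⟨by linarith [hs.1], by linarith [hs.2]⟩).continuousAt.continuousWithinAt
    obtain ⟨K, hK⟩ := (hY.locallyLipschitzOn
      (s := α n '' Icc (-a) a ∪ α k '' Icc (-a) a)).exists_lipschitzOnWith_of_compact
        ((hc n han).union (hc k hak))
    have h0a : 0 < a := (abs_nonneg t).trans_lt hta
    refine ODE_solution_unique_of_mem_Ioo (v := fun _ => Y) (K := K)
      (s := fun _ => α n '' Icc (-a) a ∪ α k '' Icc (-a) a) (a := -a) (b := a) (t₀ := 0)
      (fun _ _ => hK) ⟨by linarith, h0a⟩ (fun s hs => ⟨hα n s ?_, ?_⟩) (fun s hs => ⟨hα k s ?_, ?_⟩)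
      (by rw [h0, h0]) (abs_lt.1 hta)
    · exact ⟨by linarith [hs.1], by linarith [hs.2]⟩
    · exact Or.inl (mem_image_of_mem _ (Ioo_subset_Icc_self hs))
    · exact ⟨by linarith [hs.1], by linarith [hs.2]⟩
    · exact Or.inr (mem_image_of_mem _ (Ioo_subset_Icc_self hs))
  have hlt : ∀ t : ℝ, |t| < (⌈|t|⌉₊ + 1 : ℕ) := fun t => by
    push_cast; linarith [Nat.le_ceil |t|]
  refine ⟨fun t => α (⌈|t|⌉₊ + 1) t, by simp [h0], fun t => ?_⟩
  have hd := hα (⌈|t|⌉₊ + 1) t (abs_lt.1 (hlt t))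
  refine hd.congr_of_eventuallyEq ?_
  have hev : ∀ᶠ s : ℝ in 𝓝 t, |s| < (⌈|t|⌉₊ + 1 : ℕ) :=
    continuous_abs.continuousAt.eventually_lt continuousAt_const (hlt t)
  filter_upwards [hev] with s hs
  exact huniq _ _ s (hlt s) hs

/-- A flow that moves upwards and points into the tube `|x - g y| ≤ ρ y` along its sides has an
integral curve that never leaves the tube. -/
theorem exists_integralCurve_in_tube {X : ℝ × ℝ → ℝ × ℝ} (hX : LocallyLipschitz X)
    {g ρ : ℝ → ℝ} (hg : ContDiff ℝ 1 g) (hρ : ContDiff ℝ 1 ρ) (hρ0 : ∀ y, 0 < ρ y) {L : ℝ}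
    (hL : ∀ x y, 0 ≤ y → |x - g y| ≤ ρ y → |(X (x, y)).1| ≤ L)
    (hup : ∀ x y, 0 ≤ y → |x - g y| ≤ ρ y → 1 / 2 ≤ (X (x, y)).2 ∧ (X (x, y)).2 ≤ 2)
    (hright : ∀ y, 0 ≤ y →
      (X (g y + ρ y, y)).1 < (deriv g y + deriv ρ y) * (X (g y + ρ y, y)).2)
    (hleft : ∀ y, 0 ≤ y →
      (deriv g y - deriv ρ y) * (X (g y - ρ y, y)).2 < (X (g y - ρ y, y)).1) :
    ∃ γ : ℝ → ℝ × ℝ, γ 0 = (g 0, 0) ∧ ∀ t, 0 ≤ t → HasDerivAt γ (X (γ t)) t ∧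
      |(γ t).1 - g (γ t).2| ≤ ρ (γ t).2 ∧ t / 2 ≤ (γ t).2 := by
  set v : ℝ × ℝ → ℝ := fun p => max p.2 0 with hv
  set h : ℝ × ℝ → ℝ := fun p => max (g (v p) - ρ (v p)) (min (g (v p) + ρ (v p)) p.1) with hh
  have hvL : LocallyLipschitz v := LipschitzWith.prod_snd.locallyLipschitz.max_const 0
  have hvg : LocallyLipschitz fun p => g (v p) := hg.locallyLipschitz.comp hvL
  have hvρ : LocallyLipschitz fun p => ρ (v p) := hρ.locallyLipschitz.comp hvL
  have hhL : LocallyLipschitz h :=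
    (hvg.sub hvρ).max ((hvg.add hvρ).min LipschitzWith.prod_fst.locallyLipschitz)
  have hv0 : ∀ p, 0 ≤ v p := fun p => le_max_right _ _
  have hmem : ∀ p, |h p - g (v p)| ≤ ρ (v p) := by
    intro p
    have := hρ0 (v p)
    rw [abs_le]
    constructor
    · have : g (v p) - ρ (v p) ≤ h p := le_max_left _ _
      linarith
    · have : h p ≤ g (v p) + ρ (v p) := max_le (by linarith) (min_le_left _ _)
      linarith
  have hY : LocallyLipschitz fun p => X (h p, v p) := hX.comp (hhL.prodMk hvL)
  have hYL : ∀ p, ‖X (h p, v p)‖ ≤ max L 2 := fun p => by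
    rw [Prod.norm_def]
    refine max_le_max (hL _ _ (hv0 p) (hmem p)) ?_
    obtain ⟨h1, h2⟩ := hup _ _ (hv0 p) (hmem p)
    rw [Real.norm_eq_abs, abs_of_nonneg (by linarith)]
    exact h2
  obtain ⟨γ, hγ0, hγ⟩ := hY.exists_forall_hasDerivAt hYL (g 0, 0)
  have hx : ∀ t, HasDerivAt (fun t => (γ t).1) (X (h (γ t), v (γ t))).1 t := fun t =>
    (hasFDerivAt_fst (𝕜 := ℝ) (p := γ t)).comp_hasDerivAt t (hγ t)
  have hy : ∀ t, HasDerivAt (fun t => (γ t).2) (X (h (γ t), v (γ t))).2 t := fun t =>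
    (hasFDerivAt_snd (𝕜 := ℝ) (p := γ t)).comp_hasDerivAt t (hγ t)
  have hyt : ∀ t, 0 ≤ t → t / 2 ≤ (γ t).2 := by
    intro t ht
    have hm : Monotone fun t => (γ t).2 - t / 2 := by
      refine monotone_of_hasDerivAt_nonneg
        (f' := fun t => (X (h (γ t), v (γ t))).2 - 1 / 2) (fun t => ?_) fun t => ?_
      · exact (hy t).sub ((hasDerivAt_id t).div_const 2)
      · have := (hup _ _ (hv0 (γ t)) (hmem (γ t))).1
        simp only [Pi.zero_apply]; linarith
    have := hm ht
    simp only [hγ0] at this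
    linarith
  have hvt : ∀ t, 0 ≤ t → v (γ t) = (γ t).2 := fun t ht =>
    max_eq_left (by linarith [hyt t ht])
  have hgd : ∀ t, HasDerivAt (fun t => g (γ t).2)
      (deriv g (γ t).2 * (X (h (γ t), v (γ t))).2) t := fun t =>
    ((hg.differentiable (by norm_num)) _).hasDerivAt.comp t (hy t)
  have hρd : ∀ t, HasDerivAt (fun t => ρ (γ t).2)
      (deriv ρ (γ t).2 * (X (h (γ t), v (γ t))).2) t := fun t =>
    ((hρ.differentiable (by norm_num)) _).hasDerivAt.comp t (hy t)
  have hR : ∀ t, 0 ≤ t → (γ t).1 ≤ g (γ t).2 + ρ (γ t).2 := by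
    intro t ht
    refine image_le_of_deriv_right_lt_deriv_boundary (a := 0) (b := t)
      (B := fun t => g (γ t).2 + ρ (γ t).2)
      (fun s _ => (hx s).continuousAt.continuousWithinAt) (fun s _ => (hx s).hasDerivWithinAt)
      (by simp only [hγ0]; linarith [hρ0 0]) (fun s => (hgd s).add (hρd s)) (fun s hs heq => ?_)
      ⟨ht, le_rfl⟩
    have hs0 : 0 ≤ (γ s).2 := by linarith [hyt s hs.1, hs.1]
    have hhs : h (γ s) = g (γ s).2 + ρ (γ s).2 := by
      simp only [hh, hvt s hs.1, heq, min_self]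
      exact max_eq_right (by linarith [hρ0 (γ s).2])
    have := hright (γ s).2 hs0
    rw [hhs, hvt s hs.1]
    linarith
  have hLft : ∀ t, 0 ≤ t → g (γ t).2 - ρ (γ t).2 ≤ (γ t).1 := by
    intro t ht
    have := image_le_of_deriv_right_lt_deriv_boundary (a := 0) (b := t)
      (f := fun t => -(γ t).1) (B := fun t => -(g (γ t).2 - ρ (γ t).2))
      (fun s _ => (hx s).neg.continuousAt.continuousWithinAt)
      (fun s _ => (hx s).neg.hasDerivWithinAt)
      (by simp only [hγ0]; linarith [hρ0 0]) (fun s => ((hgd s).sub (hρd s)).neg)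
      (fun s hs heq => ?_) (x := t) ⟨ht, le_rfl⟩
    · linarith
    have hs0 : 0 ≤ (γ s).2 := by linarith [hyt s hs.1, hs.1]
    have heq' : (γ s).1 = g (γ s).2 - ρ (γ s).2 := by linarith
    have hhs : h (γ s) = g (γ s).2 - ρ (γ s).2 := by
      simp only [hh, hvt s hs.1, heq']
      exact max_eq_left (min_le_right _ _)
    have := hleft (γ s).2 hs0
    rw [hhs, hvt s hs.1]
    linarith
  refine ⟨γ, hγ0, fun t ht => ⟨?_, ?_, hyt t ht⟩⟩
  · have hhs : h (γ t) = (γ t).1 := by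
      simp only [hh, hvt t ht]
      rw [min_eq_right (hR t ht), max_eq_right (hLft t ht)]
    have := hγ t
    rwa [hhs, hvt t ht] at this
  · rw [abs_le]
    constructor <;> linarith [hR t ht, hLft t ht]

/-- A smooth step from `0` to `1` that is constant outside `[1/4, 3/4]`. -/
noncomputable def smoothStep (y : ℝ) : ℝ := Real.smoothTransition (2 * y - 1 / 2)

lemma smoothStep_of_le {y : ℝ} (h : y ≤ 1 / 4) : smoothStep y = 0 :=
  Real.smoothTransition.zero_of_nonpos (by linarith)

lemma smoothStep_of_ge {y : ℝ} (h : 3 / 4 ≤ y) : smoothStep y = 1 :=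
  Real.smoothTransition.one_of_one_le (by linarith)

lemma contDiff_smoothStep {n : ℕ∞} : ContDiff ℝ n smoothStep :=
  Real.smoothTransition.contDiff.comp ((contDiff_const.mul contDiff_id).sub contDiff_const)

lemma exists_bound_deriv_smoothStep :
    ∃ M : ℝ, 1 ≤ M ∧ (∀ y, |deriv smoothStep y| ≤ M) ∧ ∀ y, |deriv (deriv smoothStep) y| ≤ M := by
  have h1 : ContDiff ℝ 1 (deriv smoothStep) :=
    (contDiff_succ_iff_deriv.1 (contDiff_smoothStep (n := 2))).2.2
  have hs : HasCompactSupport (deriv smoothStep) := by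
    refine HasCompactSupport.intro (isCompact_Icc (a := (0 : ℝ)) (b := 1)) fun y hy => ?_
    rcases lt_or_ge y 0 with h | h
    · have : smoothStep =ᶠ[𝓝 y] fun _ => 0 := by
        filter_upwards [gt_mem_nhds h] with s hs
        exact smoothStep_of_le (by linarith)
      rw [this.deriv_eq]; simp
    · have h' : 1 < y := by by_contra! h''; exact hy ⟨h, h''⟩
      have : smoothStep =ᶠ[𝓝 y] fun _ => 1 := by
        filter_upwards [lt_mem_nhds h'] with s hs
        exact smoothStep_of_ge (by linarith)
      rw [this.deriv_eq]; simp
  obtain ⟨M₁, hM₁⟩ := h1.continuous.bounded_above_of_compact_support hs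
  obtain ⟨M₂, hM₂⟩ := (h1.continuous_deriv le_rfl).bounded_above_of_compact_support hs.deriv
  exact ⟨max 1 (max M₁ M₂), le_max_left _ _,
    fun y => (hM₁ y).trans ((le_max_left _ _).trans (le_max_right _ _)),
    fun y => (hM₂ y).trans ((le_max_right _ _).trans (le_max_right _ _))⟩

/-- Smooth interpolation of a sequence that is locally constant near the natural numbers. -/
noncomputable def interp (a : ℕ → ℝ) (y : ℝ) : ℝ :=
  a ⌊y⌋₊ + (a (⌊y⌋₊ + 1) - a ⌊y⌋₊) * smoothStep (y - ⌊y⌋₊)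

lemma interp_of_abs_sub_le (a : ℕ → ℝ) {y : ℝ} {k : ℕ} (h : |y - k| ≤ 1 / 4) :
    interp a y = a k := by
  obtain ⟨h1, h2⟩ := abs_le.1 h
  rcases lt_or_ge y k with hk | hk
  · rcases k with _ | k
    · have hf : ⌊y⌋₊ = 0 := Nat.floor_of_nonpos (by simpa using hk.le)
      rw [interp, hf, smoothStep_of_le (by simp at hk ⊢; linarith)]; simp
    · push_cast at h1 h2 hk
      have hf : ⌊y⌋₊ = k := by
        rw [Nat.floor_eq_iff (by have : (0 : ℝ) ≤ k := k.cast_nonneg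
                                 linarith)]
        constructor <;> linarith
      rw [interp, hf, smoothStep_of_ge (by linarith)]; ring
  · have hf : ⌊y⌋₊ = k := by
      rw [Nat.floor_eq_iff (by have : (0 : ℝ) ≤ k := k.cast_nonneg
                               linarith)]
      constructor <;> linarith
    rw [interp, hf, smoothStep_of_le (by linarith)]; ring

lemma interp_eventuallyEq (a : ℕ → ℝ) (y : ℝ) :
    interp a =ᶠ[𝓝 y] fun s => a ⌊y⌋₊ + (a (⌊y⌋₊ + 1) - a ⌊y⌋₊) * smoothStep (s - ⌊y⌋₊) := by
  filter_upwards [Metric.ball_mem_nhds y (by norm_num : (0 : ℝ) < 1 / 4)] with s hs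
  rw [Metric.mem_ball, Real.dist_eq, abs_lt] at hs
  have hy1 : y < ⌊y⌋₊ + 1 := Nat.lt_floor_add_one y
  rcases le_or_gt y 0 with hy0 | hy0
  · have hf : ⌊y⌋₊ = 0 := Nat.floor_of_nonpos hy0
    have hs' : ⌊s⌋₊ = 0 := Nat.floor_eq_zero.2 (by linarith)
    rw [interp, hf, hs']
  have hy2 : (⌊y⌋₊ : ℝ) ≤ y := Nat.floor_le hy0.le
  rcases lt_or_ge s ⌊y⌋₊ with h | h
  · rw [interp_of_abs_sub_le a (k := ⌊y⌋₊) (abs_le.2 ⟨by linarith, by linarith⟩),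
      smoothStep_of_le (by linarith)]; ring
  rcases lt_or_ge s (⌊y⌋₊ + 1) with h' | h'
  · have hf : ⌊s⌋₊ = ⌊y⌋₊ := by
      rw [Nat.floor_eq_iff (le_trans (Nat.cast_nonneg _) h)]
      exact ⟨h, h'⟩
    rw [interp, hf]
  · rw [interp_of_abs_sub_le a (k := ⌊y⌋₊ + 1)
      (abs_le.2 ⟨by push_cast; linarith, by push_cast; linarith⟩),
      smoothStep_of_ge (by linarith)]; ring

lemma contDiff_interp (a : ℕ → ℝ) {n : ℕ∞} : ContDiff ℝ n (interp a) := by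
  rw [contDiff_iff_contDiffAt]
  intro y
  refine ContDiffAt.congr_of_eventuallyEq ?_ (interp_eventuallyEq a y)
  exact (contDiff_const.add (contDiff_const.mul
    (contDiff_smoothStep.comp (contDiff_id.sub contDiff_const)))).contDiffAt

lemma deriv_interp_eventuallyEq (a : ℕ → ℝ) (y : ℝ) : deriv (interp a) =ᶠ[𝓝 y] fun s =>
    (a (⌊y⌋₊ + 1) - a ⌊y⌋₊) * deriv smoothStep (s - ⌊y⌋₊) := by
  filter_upwards [(interp_eventuallyEq a y).deriv] with s hs
  rw [hs, deriv_const_add, deriv_const_mul_field, deriv_comp_sub_const]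

lemma abs_deriv_interp_le {a : ℕ → ℝ} {b M : ℝ} (ha : ∀ k, 0 ≤ a k ∧ a k ≤ b)
    (hM : ∀ y, |deriv smoothStep y| ≤ M) (y : ℝ) : |deriv (interp a) y| ≤ b * M := by
  rw [(deriv_interp_eventuallyEq a y).eq_of_nhds, abs_mul]
  refine mul_le_mul ?_ (hM _) (abs_nonneg _) ((ha 0).1.trans (ha 0).2)
  rw [abs_le]
  constructor <;> linarith [ha ⌊y⌋₊, ha (⌊y⌋₊ + 1)]

lemma abs_deriv_deriv_interp_le {a : ℕ → ℝ} {b M : ℝ} (ha : ∀ k, 0 ≤ a k ∧ a k ≤ b)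
    (hM : ∀ y, |deriv (deriv smoothStep) y| ≤ M) (y : ℝ) :
    |deriv (deriv (interp a)) y| ≤ b * M := by
  rw [(deriv_interp_eventuallyEq a y).deriv_eq, deriv_const_mul_field, deriv_comp_sub_const,
    abs_mul]
  refine mul_le_mul ?_ (hM _) (abs_nonneg _) ((ha 0).1.trans (ha 0).2)
  rw [abs_le]
  constructor <;> linarith [ha ⌊y⌋₊, ha (⌊y⌋₊ + 1)]

lemma interp_mem {S : Set ℝ} (hS : Convex ℝ S) {a : ℕ → ℝ} (ha : ∀ k, a k ∈ S) (y : ℝ) :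
    interp a y ∈ S := by
  have h := hS.add_smul_sub_mem (ha ⌊y⌋₊) (ha (⌊y⌋₊ + 1)) (t := smoothStep (y - ⌊y⌋₊))
    ⟨Real.smoothTransition.nonneg _, Real.smoothTransition.le_one _⟩
  rw [smul_eq_mul, mul_comm] at h
  exact h

lemma ContDiff.deriv_of_three {g : ℝ → ℝ} (hg : ContDiff ℝ 3 g) : ContDiff ℝ 2 (deriv g) := by
  have h : ContDiff ℝ (2 + 1) g := hg.of_le (by norm_num)
  exact (contDiff_succ_iff_deriv.1 h).2.2

/-- A potential whose gradient is nearly vertical along the axis of the tube `|x - g y| ≤ ρ y`, up to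
the slope of the axis, and pulls towards the axis with strength `κ`. -/
noncomputable def tubePotential (κ : ℝ) (g ρ : ℝ → ℝ) (p : ℝ × ℝ) : ℝ :=
  (∫ s in (0 : ℝ)..p.2, (1 + deriv g s ^ 2)) + deriv g p.2 * (p.1 - g p.2)
    - κ / 2 * ((p.1 - g p.2) ^ 2 / ρ p.2)

lemma contDiff_tubePotential (κ : ℝ) {g ρ : ℝ → ℝ} (hg : ContDiff ℝ 3 g) (hρ : ContDiff ℝ 2 ρ)
    (hρ0 : ∀ y, 0 < ρ y) : ContDiff ℝ 2 (tubePotential κ g ρ) := by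
  have hg' : ContDiff ℝ 2 (deriv g) := hg.deriv_of_three
  have hg2 : ContDiff ℝ 2 g := hg.of_le (by norm_num)
  have hc : Continuous fun s => 1 + deriv g s ^ 2 := by
    have := hg'.continuous
    fun_prop
  have hW : ContDiff ℝ 2 fun y : ℝ => ∫ s in (0 : ℝ)..y, (1 + deriv g s ^ 2) := by
    have hd : ∀ y, HasDerivAt (fun y : ℝ => ∫ s in (0 : ℝ)..y, (1 + deriv g s ^ 2))
        (1 + deriv g y ^ 2) y := fun y => hc.integral_hasStrictDerivAt 0 y |>.hasDerivAt
    have : ContDiff ℝ (1 + 1) fun y : ℝ => ∫ s in (0 : ℝ)..y, (1 + deriv g s ^ 2) := by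
      refine contDiff_succ_iff_deriv.2 ⟨fun y => (hd y).differentiableAt, by simp, ?_⟩
      rw [show deriv _ = _ from funext fun y => (hd y).deriv]
      exact (contDiff_const.add (hg'.pow 2)).of_le (by norm_num)
    exact this.of_le (by norm_num)
  have hs : ContDiff ℝ 2 fun p : ℝ × ℝ => p.1 - g p.2 := contDiff_fst.sub (hg2.comp contDiff_snd)
  exact ((hW.comp contDiff_snd).add ((hg'.comp contDiff_snd).mul hs)).sub
    (contDiff_const.mul ((hs.pow 2).div (hρ.comp contDiff_snd) fun p => (hρ0 p.2).ne'))

lemma fderiv_apply_fst_of_hasDerivAt {H : ℝ × ℝ → ℝ} {x y d : ℝ}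
    (hH : DifferentiableAt ℝ H (x, y)) (hd : HasDerivAt (fun x => H (x, y)) d x) :
    fderiv ℝ H (x, y) (1, 0) = d :=
  (hH.hasFDerivAt.comp_hasDerivAt x ((hasDerivAt_id x).prodMk (hasDerivAt_const x y))).unique hd

lemma fderiv_apply_snd_of_hasDerivAt {H : ℝ × ℝ → ℝ} {x y d : ℝ}
    (hH : DifferentiableAt ℝ H (x, y)) (hd : HasDerivAt (fun y => H (x, y)) d y) :
    fderiv ℝ H (x, y) (0, 1) = d :=
  (hH.hasFDerivAt.comp_hasDerivAt y ((hasDerivAt_const y x).prodMk (hasDerivAt_id y))).unique hd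

lemma fderiv_tubePotential_fst (κ : ℝ) {g ρ : ℝ → ℝ} (hg : ContDiff ℝ 3 g) (hρ : ContDiff ℝ 2 ρ)
    (hρ0 : ∀ y, 0 < ρ y) (x y : ℝ) : fderiv ℝ (tubePotential κ g ρ) (x, y) (1, 0) =
      deriv g y - κ * ((x - g y) / ρ y) := by
  refine fderiv_apply_fst_of_hasDerivAt
    ((contDiff_tubePotential κ hg hρ hρ0).differentiable (by norm_num) _) ?_
  have hs : HasDerivAt (fun x => x - g y) 1 x := (hasDerivAt_id x).sub_const _
  have := ((hs.const_mul (deriv g y)).const_add (∫ s in (0 : ℝ)..y, (1 + deriv g s ^ 2))).sub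
    (((hs.pow 2).div_const (ρ y)).const_mul (κ / 2))
  refine this.congr_deriv ?_
  simp; ring

lemma fderiv_tubePotential_snd (κ : ℝ) {g ρ : ℝ → ℝ} (hg : ContDiff ℝ 3 g) (hρ : ContDiff ℝ 2 ρ)
    (hρ0 : ∀ y, 0 < ρ y) (x y : ℝ) : fderiv ℝ (tubePotential κ g ρ) (x, y) (0, 1) =
      1 + deriv (deriv g) y * (x - g y) + κ * deriv g y * ((x - g y) / ρ y)
        + κ / 2 * deriv ρ y * ((x - g y) / ρ y) ^ 2 := by
  refine fderiv_apply_snd_of_hasDerivAt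
    ((contDiff_tubePotential κ hg hρ hρ0).differentiable (by norm_num) _) ?_
  have hg' : ContDiff ℝ 2 (deriv g) := hg.deriv_of_three
  have hc : Continuous fun s => 1 + deriv g s ^ 2 := by
    have := hg'.continuous
    fun_prop
  have hW := (hc.integral_hasStrictDerivAt 0 y).hasDerivAt
  have hgd : HasDerivAt g (deriv g y) y := (hg.differentiable (by norm_num) y).hasDerivAt
  have hg'd : HasDerivAt (deriv g) (deriv (deriv g) y) y :=
    (hg'.differentiable (by norm_num) y).hasDerivAt
  have hρd : HasDerivAt ρ (deriv ρ y) y := (hρ.differentiable (by norm_num) y).hasDerivAt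
  have hs : HasDerivAt (fun y => x - g y) (-deriv g y) y := hgd.const_sub x
  have := (hW.add (hg'd.mul hs)).sub (((hs.pow 2).div hρd (hρ0 y).ne').const_mul (κ / 2))
  refine this.congr_deriv ?_
  have := (hρ0 y).ne'
  simp
  field_simp
  ring

lemma abs_mul_le_of {a b A B : ℝ} (ha : |a| ≤ A) (hb : |b| ≤ B) : |a * b| ≤ A * B := by
  rw [abs_mul]
  exact mul_le_mul ha hb (abs_nonneg _) ((abs_nonneg _).trans ha)

/-- Bounds on a tube that guarantee that the gradient of its potential traps the flow with a definite
margin. -/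
structure IsNarrowTube (M : ℝ) (g ρ : ℝ → ℝ) : Prop where
  contDiff_axis : ContDiff ℝ 3 g
  contDiff_radius : ContDiff ℝ 2 ρ
  radius_pos : ∀ y, 0 < ρ y
  abs_deriv_le : ∀ y, |deriv g y| ≤ M
  abs_deriv_deriv_le : ∀ y, |deriv (deriv g) y| ≤ M
  radius_le : ∀ y, ρ y ≤ 1 / (1024 * M ^ 3)
  abs_deriv_radius_le : ∀ y, |deriv ρ y| ≤ 1 / (1024 * M ^ 3)

namespace IsNarrowTube

variable {M : ℝ} {g ρ : ℝ → ℝ}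

lemma abs_fderiv_snd_sub_one_le (h : IsNarrowTube M g ρ) (hM : 1 ≤ M) {x y : ℝ}
    (hx : |x - g y| ≤ ρ y) :
    |fderiv ℝ (tubePotential (1 / (16 * M)) g ρ) (x, y) (0, 1) - 1| ≤ 1 / 8 := by
  rw [fderiv_tubePotential_snd _ h.contDiff_axis h.contDiff_radius h.radius_pos]
  have hr := h.radius_pos y
  have hw : |(x - g y) / ρ y| ≤ 1 := by
    rw [abs_div, abs_of_pos hr]; exact div_le_one_of_le₀ hx hr.le
  have hM2 : (1 : ℝ) ≤ M ^ 2 := one_le_pow₀ hM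
  have hM3 : (1 : ℝ) ≤ M ^ 3 := one_le_pow₀ hM
  have hd : (1 : ℝ) / (1024 * M ^ 3) ≤ 1 / 1024 :=
    one_div_le_one_div_of_le (by norm_num) (by linarith)
  have hκ : |1 / (16 * M)| ≤ 1 / 16 := by
    rw [abs_of_pos (by positivity)]
    exact one_div_le_one_div_of_le (by norm_num) (by linarith)
  have h1 : |deriv (deriv g) y * (x - g y)| ≤ 1 / 1024 := by
    refine (abs_mul_le_of (h.abs_deriv_deriv_le y) (hx.trans (h.radius_le y))).trans ?_
    rw [mul_one_div, div_le_div_iff₀ (by positivity) (by norm_num)]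
    nlinarith
  have h2 : |1 / (16 * M) * deriv g y * ((x - g y) / ρ y)| ≤ 1 / 16 := by
    refine (abs_mul_le_of (abs_mul_le_of (A := 1 / (16 * M)) (abs_of_pos (by positivity)).le
      (h.abs_deriv_le y)) hw).trans (le_of_eq ?_)
    field_simp
  have h3 : |1 / (16 * M) / 2 * deriv ρ y * ((x - g y) / ρ y) ^ 2| ≤ 1 / 16 / 2 * (1 / 1024) * 1 := by
    refine abs_mul_le_of (abs_mul_le_of ?_ ((h.abs_deriv_radius_le y).trans hd)) ?_
    · rw [abs_div, abs_two]; linarith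
    · rw [abs_pow]; exact pow_le_one₀ (abs_nonneg _) hw
  rw [abs_le] at h1 h2 h3 ⊢
  constructor <;> linarith [h1.1, h1.2, h2.1, h2.2, h3.1, h3.2]

lemma abs_fderiv_fst_le (h : IsNarrowTube M g ρ) (hM : 1 ≤ M) {x y : ℝ}
    (hx : |x - g y| ≤ ρ y) :
    |fderiv ℝ (tubePotential (1 / (16 * M)) g ρ) (x, y) (1, 0)| ≤ M + 1 := by
  rw [fderiv_tubePotential_fst _ h.contDiff_axis h.contDiff_radius h.radius_pos]
  have hr := h.radius_pos y
  have hw : |(x - g y) / ρ y| ≤ 1 := by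
    rw [abs_div, abs_of_pos hr]; exact div_le_one_of_le₀ hx hr.le
  have hκ : |1 / (16 * M)| ≤ 1 := by
    rw [abs_of_pos (by positivity)]
    exact div_le_one_of_le₀ (by linarith) (by positivity)
  have h1 := abs_mul_le_of hκ hw
  have h2 := h.abs_deriv_le y
  rw [abs_le] at h1 h2 ⊢
  constructor <;> linarith [h1.1, h1.2, h2.1, h2.2]

/-- The transversal component of the gradient along the side `x = g y + ε ρ y`, `ε = ±1`. -/
lemma transversal_le (h : IsNarrowTube M g ρ) (hM : 1 ≤ M) {ε : ℝ} (hε : ε = 1 ∨ ε = -1) (y : ℝ) :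
    ε * (fderiv ℝ (tubePotential (1 / (16 * M)) g ρ) (g y + ε * ρ y, y) (1, 0) -
      (deriv g y + ε * deriv ρ y) *
        fderiv ℝ (tubePotential (1 / (16 * M)) g ρ) (g y + ε * ρ y, y) (0, 1)) ≤
      -(1 / (32 * M)) := by
  have hr := h.radius_pos y
  have hε2 : ε * ε = 1 := by rcases hε with rfl | rfl <;> norm_num
  have hεa : |ε| = 1 := by rcases hε with rfl | rfl <;> norm_num
  have hb := h.abs_fderiv_snd_sub_one_le hM (x := g y + ε * ρ y) (y := y)
    (by rw [add_sub_cancel_left, abs_mul, hεa, one_mul, abs_of_pos hr])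
  rw [fderiv_tubePotential_fst _ h.contDiff_axis h.contDiff_radius h.radius_pos]
  set b := fderiv ℝ (tubePotential (1 / (16 * M)) g ρ) (g y + ε * ρ y, y) (0, 1) with hbdef
  have hbv := fderiv_tubePotential_snd (1 / (16 * M)) h.contDiff_axis h.contDiff_radius
    h.radius_pos (g y + ε * ρ y) y
  rw [← hbdef] at hbv
  have hw : (g y + ε * ρ y - g y) / ρ y = ε := by field_simp; ring
  rw [hw, add_sub_cancel_left] at hbv
  rw [hw]
  have hM2 : (1 : ℝ) ≤ M ^ 2 := one_le_pow₀ hM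
  have hM0 : 0 < M := by linarith
  set κ : ℝ := 1 / (16 * M) with hκ
  have hκ0 : 0 < κ := by positivity
  have hδ : 1 / (1024 * M ^ 3) * M ^ 2 = κ / 64 := by rw [hκ]; field_simp; norm_num
  have hδ0 : 0 < 1 / (1024 * M ^ 3) := by positivity
  have hδ1 : 1 / (1024 * M ^ 3) ≤ κ / 64 := by nlinarith
  have hR := (h.abs_deriv_radius_le y).trans hδ1
  have h1 : |deriv g y * deriv (deriv g) y * ρ y| ≤ κ / 64 := by
    refine (abs_mul_le_of (abs_mul_le_of (h.abs_deriv_le y) (h.abs_deriv_deriv_le y))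
      ((abs_of_pos hr).le.trans (h.radius_le y))).trans ?_
    nlinarith
  have h2 : |κ / 2 * deriv g y * deriv ρ y * ε| ≤ κ / 2 * M * (κ / 64) * 1 :=
    abs_mul_le_of (abs_mul_le_of (abs_mul_le_of (abs_of_pos (by positivity)).le (h.abs_deriv_le y))
      hR) hεa.le
  have hκM : κ * M = 1 / 16 := by rw [hκ]; field_simp
  have h2' : κ / 2 * M * (κ / 64) * 1 = κ / 2048 := by linear_combination (κ / 128) * hκM
  rw [h2'] at h2
  have h3 := abs_mul_le_of hR hb
  have key : ε * (deriv g y - κ * ε - (deriv g y + ε * deriv ρ y) * b) =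
      -κ - κ * deriv g y ^ 2 - deriv g y * deriv (deriv g) y * ρ y
        - κ / 2 * deriv g y * deriv ρ y * ε - deriv ρ y - deriv ρ y * (b - 1) := by
    have e1 : ε * (deriv g y - κ * ε - (deriv g y + ε * deriv ρ y) * b) =
        -κ - ε * deriv g y * (b - 1) - deriv ρ y - deriv ρ y * (b - 1) := by
      linear_combination (-κ - deriv ρ y * b) * hε2
    rw [e1, sub_left_inj, sub_left_inj]
    rw [hbv]
    linear_combination (-deriv g y * deriv (deriv g) y * ρ y - κ * deriv g y ^ 2
      - κ / 2 * deriv g y * deriv ρ y * ε) * hε2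
  have hκ2 : 1 / (32 * M) = κ / 2 := by rw [hκ]; field_simp; norm_num
  rw [key, hκ2]
  have hsq : 0 ≤ κ * deriv g y ^ 2 := by positivity
  rw [abs_le] at h1 h2 h3 hR
  linarith [h1.1, h2.1, h3.1, hR.1]

end IsNarrowTube

/-- Functions given on the disjoint strips around `x = 2 i` are restrictions of a single function. -/
lemma exists_contDiff_patch {Q : ℕ → ℝ × ℝ → ℝ} (hQ : ∀ i, ContDiff ℝ 2 (Q i)) :
    ∃ H : ℝ × ℝ → ℝ, ContDiff ℝ 2 H ∧ ∀ (i : ℕ) (p : ℝ × ℝ), -(1 / 4) < p.1 - 2 * i →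
      p.1 - 2 * i < 3 / 4 → fderiv ℝ H p = fderiv ℝ (Q i) p := by
  set β : ℝ → ℝ := fun x => Real.smoothTransition (4 * x + 2) * Real.smoothTransition (4 - 4 * x)
    with hβ
  have hST : ContDiff ℝ 2 Real.smoothTransition := Real.smoothTransition.contDiff
  have hβc : ContDiff ℝ 2 β :=
    (hST.comp ((contDiff_const.mul contDiff_id).add contDiff_const)).mul
      (hST.comp (contDiff_const.sub (contDiff_const.mul contDiff_id)))
  have hβ0 : ∀ x, x ≤ -(1 / 2) ∨ 1 ≤ x → β x = 0 := by
    rintro x (hx | hx)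
    · simp only [hβ]; rw [Real.smoothTransition.zero_of_nonpos (by linarith), zero_mul]
    · simp only [hβ]
      rw [Real.smoothTransition.zero_of_nonpos (x := 4 - 4 * x) (by linarith), mul_zero]
  have hβ1 : ∀ x, -(1 / 4) ≤ x → x ≤ 3 / 4 → β x = 1 := by
    intro x h1 h2
    simp only [hβ]
    rw [Real.smoothTransition.one_of_one_le (by linarith),
      Real.smoothTransition.one_of_one_le (by linarith), one_mul]
  set n : ℝ → ℕ := fun x => ⌊(x + 3 / 4) / 2⌋₊ with hn
  have hn1 : ∀ x, x < 2 * n x + 5 / 4 := fun x => by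
    have : (x + 3 / 4) / 2 < n x + 1 := Nat.lt_floor_add_one _
    linarith
  have hn2 : ∀ x, 0 < n x → 2 * (n x : ℝ) - 3 / 4 ≤ x := fun x hx => by
    have : (n x : ℝ) ≤ (x + 3 / 4) / 2 := Nat.floor_le (by
      by_contra! h
      exact hx.ne' (Nat.floor_of_nonpos h.le))
    linarith
  have hev : ∀ p : ℝ × ℝ, (fun p => β (p.1 - 2 * n p.1) * Q (n p.1) p) =ᶠ[𝓝 p]
      fun s => β (s.1 - 2 * n p.1) * Q (n p.1) s := by
    intro p
    filter_upwards [(continuous_fst.tendsto p) (Metric.ball_mem_nhds p.1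
      (by norm_num : (0 : ℝ) < 1 / 4))] with s hs
    rw [mem_preimage, Metric.mem_ball, Real.dist_eq, abs_lt] at hs
    rcases lt_trichotomy (n s.1) (n p.1) with h | h | h
    · have h' : (n s.1 : ℝ) + 1 ≤ n p.1 := by exact_mod_cast h
      have := hn2 p.1 (by omega)
      have := hn1 s.1
      rw [hβ0 _ (Or.inr (by linarith)), hβ0 _ (Or.inl (by linarith))]; simp
    · rw [h]
    · have h' : (n p.1 : ℝ) + 1 ≤ n s.1 := by exact_mod_cast h
      have := hn2 s.1 (by omega)
      have := hn1 p.1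
      rw [hβ0 _ (Or.inl (by linarith)), hβ0 _ (Or.inr (by linarith))]; simp
  refine ⟨fun p => β (p.1 - 2 * n p.1) * Q (n p.1) p, ?_, fun i p h1 h2 => ?_⟩
  · rw [contDiff_iff_contDiffAt]
    intro p
    refine ContDiffAt.congr_of_eventuallyEq ?_ (hev p)
    exact ((hβc.comp (contDiff_fst.sub contDiff_const)).mul (hQ _)).contDiffAt
  · have hi : n p.1 = i := by
      rw [hn]
      have : (0 : ℝ) ≤ i := i.cast_nonneg
      rw [Nat.floor_eq_iff (by linarith)]
      constructor <;> linarith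
    refine Filter.EventuallyEq.fderiv_eq ?_
    have hc : Continuous fun s : ℝ × ℝ => s.1 - 2 * i := continuous_fst.sub continuous_const
    filter_upwards [hev p, hc.continuousAt.eventually_const_lt h1,
      hc.continuousAt.eventually_lt_const h2] with s hs hs1 hs2
    rw [hs, hi, hβ1 _ hs1.le hs2.le, one_mul]

/-- Any sequence of narrow tubes around graphs over the strips `[2 i, 2 i + 1/2]` is followed by
integral curves of a Beltrami field inside an invariant plane. -/
theorem exists_beltrami_following_tubes {M : ℝ} (hM : 1 ≤ M) {g ρ : ℕ → ℝ → ℝ}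
    (h : ∀ i, IsNarrowTube M (g i) (ρ i)) (hg0 : ∀ (i : ℕ) y, 2 * (i : ℝ) ≤ g i y)
    (hg1 : ∀ (i : ℕ) y, g i y ≤ 2 * i + 1 / 2) :
    ∃ u : ℝ × ℝ × ℝ → ℝ × ℝ × ℝ, (∀ p, AnalyticAt ℝ u p) ∧ (∀ p, curl3 u p = u p) ∧
      (∀ x y, (u (x, y, 0)).2.2 = 0) ∧ ∀ i, ∃ γ : ℝ → ℝ × ℝ × ℝ, γ 0 = (g i 0, 0, 0) ∧
        ∀ t, 0 ≤ t → HasDerivAt γ (u (γ t)) t ∧ (γ t).2.2 = 0 ∧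
          |(γ t).1 - g i (γ t).2.1| ≤ ρ i (γ t).2.1 ∧ t / 2 ≤ (γ t).2.1 := by
  have hM0 : 0 < M := by linarith
  set κ : ℝ := 1 / (16 * M) with hκ
  set η : ℝ := 1 / (128 * M ^ 2) with hη
  have hη0 : 0 < η := by positivity
  obtain ⟨H, hH, hHQ⟩ := exists_contDiff_patch fun i =>
    contDiff_tubePotential κ (h i).contDiff_axis (h i).contDiff_radius (h i).radius_pos
  obtain ⟨c, hc, F', hF'⟩ := exists_entire_potential_of_contDiff hH hη0
  obtain ⟨u, hua, huc, huz, hux, huy⟩ := exists_beltrami_of_potential hc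
  refine ⟨u, hua, huc, huz, fun i => ?_⟩
  set X : ℝ × ℝ → ℝ × ℝ := fun p => ((u (p.1, p.2, 0)).1, (u (p.1, p.2, 0)).2.1) with hX
  have huC : ContDiff ℝ 1 u := contDiff_iff_contDiffAt.2 fun p => (hua p).contDiffAt
  have hXC : ContDiff ℝ 1 X := by
    have h3 : ContDiff ℝ 1 fun p : ℝ × ℝ => u (p.1, p.2, 0) :=
      huC.comp (contDiff_fst.prodMk (contDiff_snd.prodMk contDiff_const))
    exact h3.fst.prodMk h3.snd.fst
  have hX1 : ∀ x y, (X (x, y)).1 = F' (x, y) (1, 0) := fun x y => by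
    rw [← (hF' (x, y)).1.fderiv]
    exact (fderiv_apply_fst_of_hasDerivAt (hF' (x, y)).1.differentiableAt (hux x y)).symm
  have hX2 : ∀ x y, (X (x, y)).2 = F' (x, y) (0, 1) := fun x y => by
    rw [← (hF' (x, y)).1.fderiv]
    exact (fderiv_apply_snd_of_hasDerivAt (hF' (x, y)).1.differentiableAt (huy x y)).symm
  have herr : ∀ (p v : ℝ × ℝ), ‖v‖ = 1 → |F' p v - fderiv ℝ H p v| ≤ η := fun p v hv => by
    have := (F' p - fderiv ℝ H p).le_of_opNorm_le (hF' p).2 v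
    simpa [hv] using this
  have hρs : ∀ y, ρ i y ≤ 1 / 8 := fun y => by
    refine ((h i).radius_le y).trans (one_div_le_one_div_of_le (by norm_num) ?_)
    have : (1 : ℝ) ≤ M ^ 3 := one_le_pow₀ hM
    linarith
  have hfd : ∀ x y, |x - g i y| ≤ ρ i y →
      fderiv ℝ H (x, y) = fderiv ℝ (tubePotential κ (g i) (ρ i)) (x, y) := fun x y hx => by
    have hx' := abs_le.1 hx
    exact hHQ i (x, y) (by simp only; linarith [hx'.1, hg0 i y, hρs y])
      (by simp only; linarith [hx'.2, hg1 i y, hρs y])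
  have hd1 : ∀ x y, |x - g i y| ≤ ρ i y →
      |(X (x, y)).1 - fderiv ℝ (tubePotential κ (g i) (ρ i)) (x, y) (1, 0)| ≤ η :=
    fun x y hx => by
      rw [hX1, ← hfd x y hx]; exact herr _ _ (by simp [Prod.norm_def])
  have hd2 : ∀ x y, |x - g i y| ≤ ρ i y →
      |(X (x, y)).2 - fderiv ℝ (tubePotential κ (g i) (ρ i)) (x, y) (0, 1)| ≤ η :=
    fun x y hx => by
      rw [hX2, ← hfd x y hx]; exact herr _ _ (by simp [Prod.norm_def])
  have hM2 : (1 : ℝ) ≤ M ^ 2 := one_le_pow₀ hM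
  have hη1 : η ≤ 1 / 128 := one_div_le_one_div_of_le (by norm_num) (by linarith)
  have hside : ∀ ε : ℝ, (ε = 1 ∨ ε = -1) → ∀ y,
      ε * ((X (g i y + ε * ρ i y, y)).1 -
        (deriv (g i) y + ε * deriv (ρ i) y) * (X (g i y + ε * ρ i y, y)).2) < 0 := by
    intro ε hε y
    have hεa : |ε| = 1 := by rcases hε with rfl | rfl <;> norm_num
    have hmem : |g i y + ε * ρ i y - g i y| ≤ ρ i y := by
      rw [add_sub_cancel_left, abs_mul, hεa, one_mul, abs_of_pos ((h i).radius_pos y)]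
    have e1 := hd1 _ _ hmem
    have e2 := hd2 _ _ hmem
    have ht := (h i).transversal_le hM hε y
    rw [← hκ] at ht
    set A := fderiv ℝ (tubePotential κ (g i) (ρ i)) (g i y + ε * ρ i y, y) (1, 0)
    set B := fderiv ℝ (tubePotential κ (g i) (ρ i)) (g i y + ε * ρ i y, y) (0, 1)
    set x1 := (X (g i y + ε * ρ i y, y)).1
    set x2 := (X (g i y + ε * ρ i y, y)).2
    have hG : |deriv (g i) y + ε * deriv (ρ i) y| ≤ 2 * M := by
      refine (abs_add_le _ _).trans ?_
      rw [abs_mul, hεa, one_mul]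
      have : (1 : ℝ) / (1024 * M ^ 3) ≤ 1 :=
        div_le_one_of_le₀ (by linarith [one_le_pow₀ hM (n := 3)]) (by positivity)
      linarith [(h i).abs_deriv_le y, (h i).abs_deriv_radius_le y]
    have f1 := abs_mul_le_of hεa.le e1
    have f2 := abs_mul_le_of hεa.le (abs_mul_le_of hG e2)
    have hηM : 2 * M * η = κ / 4 := by rw [hη, hκ]; field_simp; norm_num
    have hκ2 : 1 / (32 * M) = κ / 2 := by rw [hκ]; field_simp; norm_num
    have hκ0 : 0 < κ := by positivity
    have hη2 : η ≤ κ / 8 := by nlinarith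
    rw [hηM] at f2
    rw [hκ2] at ht
    have := le_of_abs_le f1
    have := neg_le_of_abs_le f2
    nlinarith
  obtain ⟨γ, hγ0, hγ⟩ := exists_integralCurve_in_tube (X := X) hXC.locallyLipschitz
    (g := g i) (ρ := ρ i) ((h i).contDiff_axis.of_le (by norm_num))
    ((h i).contDiff_radius.of_le (by norm_num)) (h i).radius_pos (L := M + 2)
    (fun x y _ hx => by
      have e1 := abs_le.1 (hd1 x y hx)
      have e2 := abs_le.1 ((h i).abs_fderiv_fst_le hM hx)
      rw [abs_le]
      constructor <;> linarith [e1.1, e1.2, e2.1, e2.2])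
    (fun x y _ hx => by
      have e1 := abs_le.1 (hd2 x y hx)
      have e2 := abs_le.1 ((h i).abs_fderiv_snd_sub_one_le hM hx)
      constructor <;> linarith [e1.1, e1.2, e2.1, e2.2])
    (fun y _ => by
      have := hside 1 (Or.inl rfl) y
      simp only [one_mul] at this
      linarith)
    (fun y _ => by
      have := hside (-1) (Or.inr rfl) y
      simp only [neg_mul, one_mul, ← sub_eq_add_neg] at this
      linarith)
  refine ⟨fun t => ((γ t).1, (γ t).2, 0), by simp [hγ0], fun t ht => ?_⟩
  obtain ⟨hd, hmem, ht2⟩ := hγ t ht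
  refine ⟨?_, rfl, hmem, ht2⟩
  have hx := (hasFDerivAt_fst (𝕜 := ℝ) (p := γ t)).comp_hasDerivAt t hd
  have hy := (hasFDerivAt_snd (𝕜 := ℝ) (p := γ t)).comp_hasDerivAt t hd
  have hd' := hx.prodMk (hy.prodMk (hasDerivAt_const t (0 : ℝ)))
  refine hd'.congr_deriv ?_
  refine Prod.ext rfl (Prod.ext rfl (huz _ _).symm)

/-- The denominator of `phiEnc`. -/
noncomputable def denomEnc {m : ℕ} (c : Config m) : ℕ :=
  2 ^ ((c.1 : ℕ) + 1) * 3 ^ rEnc c.2 * 5 ^ sEnc c.2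

lemma phiEnc_eq_inv_denomEnc {m : ℕ} (c : Config m) : phiEnc c = 1 / (denomEnc c : ℝ) := by
  simp [phiEnc, denomEnc]

lemma two_le_denomEnc {m : ℕ} (c : Config m) : 2 ≤ denomEnc c := by
  have h3 : 1 ≤ 3 ^ rEnc c.2 := Nat.one_le_pow _ _ (by norm_num)
  have h5 : 1 ≤ 5 ^ sEnc c.2 := Nat.one_le_pow _ _ (by norm_num)
  have h2 : 1 ≤ 2 ^ (c.1 : ℕ) := Nat.one_le_pow _ _ (by norm_num)
  calc 2 = 2 * 1 * 1 * 1 := by norm_num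
    _ ≤ 2 * 2 ^ (c.1 : ℕ) * 3 ^ rEnc c.2 * 5 ^ sEnc c.2 := by gcongr
    _ = denomEnc c := by simp only [denomEnc, pow_succ]; ring

lemma Tape.sum_filter_eq_geomSum (t : Tape) (p : ℤ → Prop) [DecidablePred p] (e : ℤ → ℕ)
    (he : ∀ i j, p i → p j → e i = e j → i = j) :
    ∑ i ∈ t.support.filter p, ((t i : ℕ) * 2 ^ e i) =
      ∑ k ∈ (t.support.filter p).image e, 2 ^ k := by
  rw [Finset.sum_image]
  · refine Finset.sum_congr rfl fun i hi => ?_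
    have : t i ≠ 0 := by simpa using (Finset.mem_filter.1 hi).1
    have h1 : t i = 1 := by omega
    simp [h1]
  · intro i hi j hj hij
    simp only [Finset.coe_filter, Set.mem_ofPred_eq] at hi hj
    exact he i j hi.2 hj.2 hij

lemma Tape.eq_of_geomSum_eq {t t' : Tape} (p : ℤ → Prop) [DecidablePred p] (e : ℤ → ℕ)
    (he : ∀ i j, p i → p j → e i = e j → i = j)
    (h : ∑ i ∈ t.support.filter p, ((t i : ℕ) * 2 ^ e i) =
      ∑ i ∈ t'.support.filter p, ((t' i : ℕ) * 2 ^ e i)) {i : ℤ} (hi : p i) : t i = t' i := by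
  rw [t.sum_filter_eq_geomSum p e he, t'.sum_filter_eq_geomSum p e he] at h
  have hS := Finset.geomSum_injective (n := 2) le_rfl h
  have key : ∀ s : Tape, s i ≠ 0 ↔ e i ∈ (s.support.filter p).image e := by
    intro s
    simp only [Finset.mem_image, Finset.mem_filter, Finsupp.mem_support_iff]
    constructor
    · exact fun h => ⟨i, ⟨h, hi⟩, rfl⟩
    · rintro ⟨j, ⟨hj, hpj⟩, hji⟩
      rwa [← he j i hpj hi hji]
  have h1 := key t
  rw [hS, ← key t'] at h1
  omega

lemma denomEnc_injective (m : ℕ) : Function.Injective (denomEnc : Config m → ℕ) := by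
  rintro ⟨q, t⟩ ⟨q', t'⟩ h
  have hfac : ∀ a b c p : ℕ, (2 ^ a * 3 ^ b * 5 ^ c).factorization p =
      a * (Nat.factorization 2 p) + b * (Nat.factorization 3 p) + c * (Nat.factorization 5 p) := by
    intro a b c p
    rw [Nat.factorization_mul (by positivity) (by positivity),
      Nat.factorization_mul (by positivity) (by positivity)]
    simp
  have h2 := congrArg (fun n => n.factorization 2) h
  have h3 := congrArg (fun n => n.factorization 3) h
  have h5 := congrArg (fun n => n.factorization 5) h
  simp only [denomEnc, hfac, Nat.prime_two.factorization, Nat.prime_three.factorization,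
    Nat.prime_five.factorization] at h2 h3 h5
  simp at h2 h3 h5
  have hq : q = q' := Fin.ext (by omega)
  have ht : t = t' := by
    ext i
    rcases le_or_gt 0 i with hi | hi
    · rw [Tape.eq_of_geomSum_eq (fun i => 0 ≤ i) Int.toNat (fun i j hi hj h => by omega) h3 hi]
    · rw [Tape.eq_of_geomSum_eq (fun i => i < 0) (fun i => (-i - 1).toNat)
        (fun i j hi hj h => by omega) h5 hi]
  rw [hq, ht]

lemma phiEnc_pos {m : ℕ} (c : Config m) : 0 < phiEnc c := by
  have := two_le_denomEnc c
  rw [phiEnc_eq_inv_denomEnc]; positivity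

lemma phiEnc_le_half {m : ℕ} (c : Config m) : phiEnc c ≤ 1 / 2 := by
  have : (2 : ℝ) ≤ denomEnc c := by exact_mod_cast two_le_denomEnc c
  rw [phiEnc_eq_inv_denomEnc]
  exact one_div_le_one_div_of_le (by norm_num) this

/-- Values of `1 / n` are separated on the quadratic scale of the coding intervals. -/
lemma abs_sub_lt_imp_denom_le {a b : ℕ} (ha : 2 ≤ a) (hb : 2 ≤ b)
    (h : |1 / (a : ℝ) - 1 / b| < (1 / (a : ℝ)) ^ 2 / 8 + (1 / (b : ℝ)) ^ 2 / 8) : b ≤ a := by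
  by_contra! hab
  have ha' : (2 : ℝ) ≤ a := by exact_mod_cast ha
  have hab' : (a : ℝ) + 1 ≤ b := by exact_mod_cast hab
  have h1 : 1 / (b : ℝ) ≤ 1 / (a + 1) := one_div_le_one_div_of_le (by linarith) hab'
  have h2 : 1 / ((a : ℝ) + 1) ≤ 1 / a := one_div_le_one_div_of_le (by linarith) (by linarith)
  have h3 : 1 / (a : ℝ) - 1 / (a + 1) = 1 / a * (1 / (a + 1)) := by field_simp; ring
  have h4 : (1 / (a : ℝ)) ^ 2 / 2 ≤ 1 / a * (1 / (a + 1)) := by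
    have : 1 / (a : ℝ) / 2 ≤ 1 / (a + 1) := by
      rw [div_div]; exact one_div_le_one_div_of_le (by linarith) (by linarith)
    have h0 : 0 < 1 / (a : ℝ) := by positivity
    nlinarith
  have h5 : (1 / (b : ℝ)) ^ 2 ≤ (1 / (a : ℝ)) ^ 2 := by
    have : 0 ≤ 1 / (b : ℝ) := by positivity
    gcongr
  have h6 : 0 < (1 / (a : ℝ)) ^ 2 := by positivity
  have := le_abs_self (1 / (a : ℝ) - 1 / b)
  nlinarith

lemma eq_of_abs_phiEnc_sub_lt {m : ℕ} {c d : Config m}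
    (h : |phiEnc c - phiEnc d| < phiEnc c ^ 2 / 8 + phiEnc d ^ 2 / 8) : c = d := by
  apply denomEnc_injective
  rw [phiEnc_eq_inv_denomEnc, phiEnc_eq_inv_denomEnc] at h
  refine le_antisymm ?_ (abs_sub_lt_imp_denom_le (two_le_denomEnc c) (two_le_denomEnc d) h)
  refine abs_sub_lt_imp_denom_le (two_le_denomEnc d) (two_le_denomEnc c) ?_
  rw [abs_sub_comm, add_comm]; exact h

/-- A planar curve that shadows the codes of a sequence of configurations in the strip around
`x = 2 i` visits exactly the sets `Uset` of the configurations in the sequence. -/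
lemma exists_mem_Uset_iff {m : ℕ} (c : ℕ → Config m) (i : ℕ) {x y : ℝ → ℝ}
    (hy : ContinuousOn y (Ici 0)) (hy0 : y 0 = 0) (hyt : ∀ t, 0 ≤ t → t / 2 ≤ y t)
    (hx : ∀ t k, 0 ≤ t → |y t - (k : ℕ)| ≤ 1 / 4 →
      |x t - 2 * i - phiEnc (c k)| < phiEnc (c k) ^ 2 / 8) (d : Config m) :
    (∃ t, 0 ≤ t ∧ (x t, y t) ∈ Uset (1 / 8) d) ↔ ∃ k, c k = d := by
  constructor
  · rintro ⟨t, ht, hmem⟩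
    simp only [Uset, mem_iUnion, mem_prod, mem_Ioo] at hmem
    obtain ⟨j, k, ⟨h1, h2⟩, h3, h4⟩ := hmem
    have hk := hx t k ht (abs_le.2 ⟨by linarith, by linarith⟩)
    refine ⟨k, ?_⟩
    have hp := phiEnc_pos d
    have hp' := phiEnc_le_half d
    have hq := phiEnc_pos (c k)
    have hq' := phiEnc_le_half (c k)
    have hk' := abs_lt.1 hk
    have hij : i = j := by
      have b1 : phiEnc d ^ 2 ≤ 1 / 4 := by nlinarith
      have b2 : phiEnc (c k) ^ 2 ≤ 1 / 4 := by nlinarith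
      have l1 : (i : ℝ) < j + 1 := by linarith [hk'.1]
      have l2 : (j : ℝ) < i + 1 := by linarith [hk'.2]
      have l1' : i < j + 1 := by exact_mod_cast l1
      have l2' : j < i + 1 := by exact_mod_cast l2
      omega
    subst hij
    apply eq_of_abs_phiEnc_sub_lt
    rw [abs_lt]
    constructor <;> linarith [hk'.1, hk'.2]
  · rintro ⟨k, rfl⟩
    have hc : ContinuousOn y (Icc 0 (2 * (k : ℝ))) := hy.mono Icc_subset_Ici_self
    have hk0 : (0 : ℝ) ≤ k := k.cast_nonneg
    obtain ⟨t, ht, hyk⟩ := intermediate_value_Icc (by linarith : (0 : ℝ) ≤ 2 * k) hc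
      (show (k : ℝ) ∈ Icc (y 0) (y (2 * k)) from
        ⟨by rw [hy0]; exact hk0, by have := hyt (2 * k) (by linarith); linarith⟩)
    have hk := abs_lt.1 (hx t k ht.1 (by rw [hyk]; norm_num))
    refine ⟨t, ht.1, ?_⟩
    simp only [Uset, mem_iUnion, mem_prod, mem_Ioo]
    exact ⟨i, k, ⟨by linarith [hk.1], by linarith [hk.2]⟩, by linarith, by linarith⟩

lemma isNarrowTube_interp {M : ℝ} (hM : 1 ≤ M) (h1 : ∀ y, |deriv smoothStep y| ≤ M)
    (h2 : ∀ y, |deriv (deriv smoothStep) y| ≤ M) (b : ℝ) {a : ℕ → ℝ}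
    (ha : ∀ k, 0 < a k ∧ a k ≤ 1) :
    IsNarrowTube M (fun y => b + interp a y) (interp fun k => 1 / (1024 * M ^ 4) * a k ^ 2) := by
  have hd : deriv (fun y => b + interp a y) = deriv (interp a) := funext fun y => deriv_const_add b
  have ha' : ∀ k, 0 ≤ a k ∧ a k ≤ 1 := fun k => ⟨(ha k).1.le, (ha k).2⟩
  have hM0 : 0 < M := by linarith
  have hr : ∀ k, 0 < 1 / (1024 * M ^ 4) * a k ^ 2 ∧
      1 / (1024 * M ^ 4) * a k ^ 2 ≤ 1 / (1024 * M ^ 4) := fun k => by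
    have := (ha k).1
    exact ⟨by positivity, mul_le_of_le_one_right (by positivity)
      (pow_le_one₀ this.le (ha k).2)⟩
  have hMM : 1 / (1024 * M ^ 4) * M = 1 / (1024 * M ^ 3) := by field_simp
  have hMM' : 1 / (1024 * M ^ 4) ≤ 1 / (1024 * M ^ 3) := by
    rw [← hMM]; exact le_mul_of_one_le_right (by positivity) hM
  refine ⟨contDiff_const.add (contDiff_interp a (n := 3)), contDiff_interp _ (n := 2),
    fun y => interp_mem (convex_Ioi 0) (fun k => (hr k).1) y, fun y => ?_, fun y => ?_,
    fun y => (interp_mem (convex_Iic _) (fun k => (hr k).2) y).trans hMM', fun y => ?_⟩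
  · rw [hd]; simpa using abs_deriv_interp_le ha' h1 y
  · rw [hd]; simpa using abs_deriv_deriv_interp_le ha' h2 y
  · rw [← hMM]; exact abs_deriv_interp_le (fun k => ⟨(hr k).1.le, (hr k).2⟩) h1 y

/-- The configurations visited by a family of sequences can be read off the integral curves of a
single Beltrami field. -/
theorem exists_beltrami_visiting {m : ℕ} (c : ℕ → ℕ → Config m) :
    ∃ u : ℝ × ℝ × ℝ → ℝ × ℝ × ℝ, (∀ p, AnalyticAt ℝ u p) ∧ (∀ p, curl3 u p = u p) ∧
      (∀ x y, (u (x, y, 0)).2.2 = 0) ∧ ∀ i : ℕ, ∃ γ : ℝ → ℝ × ℝ × ℝ,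
        γ 0 = (2 * (i : ℝ) + phiEnc (c i 0), 0, 0) ∧
        (∀ t, 0 ≤ t → HasDerivAt γ (u (γ t)) t) ∧ (∀ t, 0 ≤ t → (γ t).2.2 = 0) ∧
        ∀ d, (∃ t, 0 ≤ t ∧ ((γ t).1, (γ t).2.1) ∈ Uset (1 / 8) d) ↔ ∃ k, c i k = d := by
  obtain ⟨M, hM, h1, h2⟩ := exists_bound_deriv_smoothStep
  have hφ : ∀ i k, 0 < phiEnc (c i k) ∧ phiEnc (c i k) ≤ 1 := fun i k =>
    ⟨phiEnc_pos _, (phiEnc_le_half _).trans (by norm_num)⟩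
  obtain ⟨u, hua, huc, huz, hu⟩ := exists_beltrami_following_tubes hM
    (fun i : ℕ => isNarrowTube_interp hM h1 h2 (2 * (i : ℝ)) (hφ i))
    (fun i y => by
      have := interp_mem (convex_Ioi (0 : ℝ)) (fun k => phiEnc_pos (c i k)) y
      linarith [mem_Ioi.1 this])
    (fun i y => by
      have := interp_mem (convex_Iic (1 / 2 : ℝ)) (fun k => phiEnc_le_half (c i k)) y
      linarith [mem_Iic.1 this])
  refine ⟨u, hua, huc, huz, fun i => ?_⟩
  obtain ⟨γ, hγ0, hγ⟩ := hu i
  have hnear0 : interp (fun k => phiEnc (c i k)) 0 = phiEnc (c i 0) :=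
    interp_of_abs_sub_le _ (by norm_num)
  refine ⟨γ, by rw [hγ0, hnear0], fun t ht => (hγ t ht).1, fun t ht => (hγ t ht).2.1, fun d => ?_⟩
  refine exists_mem_Uset_iff (c i) i (x := fun t => (γ t).1) (y := fun t => (γ t).2.1)
    (fun t ht => ?_) (by simp [hγ0]) (fun t ht => (hγ t ht).2.2.2) (fun t k ht hk => ?_) d
  · exact ((hγ t ht).1.continuousAt.snd.fst).continuousWithinAt
  · have h := (hγ t ht).2.2.1
    rw [interp_of_abs_sub_le _ hk, interp_of_abs_sub_le _ hk] at h
    rw [sub_sub]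
    refine h.trans_lt ?_
    have hp := pow_pos (phiEnc_pos (c i k)) 2
    have hM4 : (1 : ℝ) ≤ M ^ 4 := one_le_pow₀ hM
    have : 1 / (1024 * M ^ 4) ≤ 1 / 1024 :=
      one_div_le_one_div_of_le (by norm_num) (by linarith)
    nlinarith

end BeltramiConstruction

/-- There exists a Turing complete Beltrami field in Euclidean `ℝ³`: a real-analytic
vector field `u` with `curl u = λ u` (`λ ≠ 0`), tangent to the plane `{z = 0}`, whose
integral curve through `(p_{cᵢ}, 0)` stays in the plane and visits `U_{(q,τ)} × {0}`
exactly for the configurations `(q,τ)` reached by the machine from `cᵢ`; in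
particular `T` halts on `cᵢ` iff the curve meets `⋃_τ U_{(q_halt,τ)} × {0}`. -/
theorem statement15 (m : ℕ) (hm : 2 ≤ m) (T : TuringMachine m) (tape : ℕ ≃ Tape) :
    ∃ (lam : ℝ) (u : ℝ × ℝ × ℝ → ℝ × ℝ × ℝ) (ε₀ : ℝ),
      lam ≠ 0 ∧ (∀ x, AnalyticAt ℝ u x) ∧ (∀ x, curl3 u x = lam • u x) ∧ 0 < ε₀ ∧
      (∀ x y : ℝ, (u (x, y, 0)).2.2 = 0) ∧
      ∀ i : ℕ, ∃ γ : ℝ → ℝ × ℝ × ℝ,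
        γ 0 = (2 * (i : ℝ) + phiEnc ((T.q0, tape i) : Config m), 0, 0) ∧
        (∀ t : ℝ, 0 ≤ t → HasDerivAt γ (u (γ t)) t) ∧
        (∀ t : ℝ, 0 ≤ t → (γ t).2.2 = 0) ∧
        (∀ c : Config m,
          (∃ t : ℝ, 0 ≤ t ∧ ((γ t).1, (γ t).2.1) ∈ Uset ε₀ c) ↔
            ∃ k : ℕ, T.step^[k] (T.q0, tape i) = c) ∧
        ((∃ k : ℕ, (T.step^[k] (T.q0, tape i)).1 = T.qhalt) ↔
          ∃ t : ℝ, 0 ≤ t ∧ ∃ τ : Tape,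
            ((γ t).1, (γ t).2.1) ∈ Uset ε₀ ((T.qhalt, τ) : Config m) ∧
            (γ t).2.2 = 0) := by
  obtain ⟨u, hua, huc, huz, hu⟩ := exists_beltrami_visiting fun i k => T.step^[k] (T.q0, tape i)
  refine ⟨1, u, 1 / 8, one_ne_zero, hua, fun x => by rw [huc, one_smul], by norm_num, huz,
    fun i => ?_⟩
  obtain ⟨γ, hγ0, hγ, hγz, hγU⟩ := hu i
  refine ⟨γ, hγ0, hγ, hγz, hγU, ?_⟩
  constructor
  · rintro ⟨k, hk⟩
    obtain ⟨t, ht, htU⟩ := (hγU (T.qhalt, (T.step^[k] (T.q0, tape i)).2)).2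
      ⟨k, Prod.ext hk rfl⟩
    exact ⟨t, ht, _, htU, hγz t ht⟩
  · rintro ⟨t, ht, τ, htU, -⟩
    obtain ⟨k, hk⟩ := (hγU (T.qhalt, τ)).1 ⟨t, ht, htU⟩
    exact ⟨k, by rw [hk]⟩
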